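/- arXiv:math/0112263 — 3 statements merged into one kernel-verified Lean document; each statement's English description precedes it below -/
import Mathlib

section
/- Let μ/λ be a fixed (shifted or unshifted) skew shape with n cells, let P and Q be two standard skew tableaux of shape μ/λ, and let π be a permutation of {1,2,…,n}. Then MJ_P(P_π) = Q if and only if MJ_Q(Q_{π⁻¹}) = P. -/
open scoped Classical

/-- A (possibly shifted) skew Ferrers shape `μ/λ`, given by two partitions
`μ ⊇ λ` (with distinct parts in the shifted case). -/
structure SkewShape where
  shifted : Bool
  mu : ℕ → ℕ
  lam : ℕ → ℕ
  mu_anti : ∀ i, mu (i + 1) ≤ mu i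
  lam_anti : ∀ i, lam (i + 1) ≤ lam i
  lam_le_mu : ∀ i, lam i ≤ mu i
  mu_fin : ∃ r, ∀ i, r ≤ i → mu i = 0
  mu_strict : shifted = true → ∀ i, mu (i + 1) ≠ 0 → mu (i + 1) < mu i
  lam_strict : shifted = true → ∀ i, lam (i + 1) ≠ 0 → lam (i + 1) < lam i

/-- The set of cells of the (shifted) skew Ferrers diagram (rows and columns
are 0-indexed; in the shifted case row `i` is indented by `i` cells). -/
def SkewShape.cells (sh : SkewShape) : Set (ℕ × ℕ) :=
  {c | if sh.shifted = true then
         c.1 + sh.lam c.1 ≤ c.2 ∧ c.2 < c.1 + sh.mu c.1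
       else sh.lam c.1 ≤ c.2 ∧ c.2 < sh.mu c.1}

/-- A tabloid of shape `D`: a bijective filling of the cells of `D` with the
integers `1,…,n` where `n = |D|` (normalized to be `0` outside `D`). -/
def IsTabloid (D : Set (ℕ × ℕ)) (f : ℕ × ℕ → ℕ) : Prop :=
  Set.BijOn f D (Set.Icc 1 D.ncard) ∧ ∀ c, c ∉ D → f c = 0

/-- A standard (skew) tableau: a tabloid with increasing rows and columns. -/
def IsStandard (D : Set (ℕ × ℕ)) (f : ℕ × ℕ → ℕ) : Prop :=
  IsTabloid D f ∧ ∀ c ∈ D,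
    ((c.1, c.2 + 1) ∈ D → f c < f (c.1, c.2 + 1)) ∧
    ((c.1 + 1, c.2) ∈ D → f c < f (c.1 + 1, c.2))

/-- Exchange the entries of two cells. -/
def swapCells (f : ℕ × ℕ → ℕ) (a b : ℕ × ℕ) : ℕ × ℕ → ℕ :=
  Function.update (Function.update f a (f b)) b (f a)

/-- The value of a cell, `⊤` ("infinity") outside the shape `D`. -/
noncomputable def jval (D : Set (ℕ × ℕ)) (f : ℕ × ℕ → ℕ) (c : ℕ × ℕ) : WithTop ℕ :=
  if c ∈ D then (f c : WithTop ℕ) else ⊤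

/-- One step of forward jeu de taquin: the cell whose entry the moving entry at
`c` is exchanged with (the smaller of the right and lower neighbours, cells
outside the shape counting as `∞`), provided the moving entry is not yet
stable; `none` if it is stable. -/
noncomputable def fjTarget (D : Set (ℕ × ℕ)) (f : ℕ × ℕ → ℕ) (c : ℕ × ℕ) :
    Option (ℕ × ℕ) :=
  let r := (c.1, c.2 + 1)
  let d := (c.1 + 1, c.2)
  if min (jval D f r) (jval D f d) < jval D f c then
    some (if jval D f r ≤ jval D f d then r else d)
  else none

/-- Iterated forward jeu de taquin on a pair of fillings, starting at cell `c`: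
the moves are driven by the first filling and the exchanges are performed
simultaneously in both fillings. -/
noncomputable def fjIter (D : Set (ℕ × ℕ)) :
    ℕ → ((ℕ × ℕ → ℕ) × (ℕ × ℕ → ℕ)) → ℕ × ℕ →
      ((ℕ × ℕ → ℕ) × (ℕ × ℕ → ℕ)) × (ℕ × ℕ)
  | 0, p, c => (p, c)
  | fuel + 1, p, c =>
    match fjTarget D p.1 c with
    | none => (p, c)
    | some c' => fjIter D fuel (swapCells p.1 c c', swapCells p.2 c c') c'

/-- Forward jeu de taquin in a single filling, starting at cell `c`. -/
noncomputable def fjRun (D : Set (ℕ × ℕ)) (f : ℕ × ℕ → ℕ) (c : ℕ × ℕ) :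
    ℕ × ℕ → ℕ :=
  ((fjIter D D.ncard (f, f) c).1).1

/-- The cell of the shape `D` carrying the entry `v` of the filling `f`. -/
noncomputable def cellOf (D : Set (ℕ × ℕ)) (f : ℕ × ℕ → ℕ) (v : ℕ) : ℕ × ℕ :=
  Classical.epsilon fun c => c ∈ D ∧ f c = v

/-- `MJaux D S n k T`: perform forward jeu de taquin with the entries of `T`
lying in the cells labelled `n, n-1, …, n-k+1` in `S`, in this order. -/
noncomputable def MJaux (D : Set (ℕ × ℕ)) (S : ℕ × ℕ → ℕ) (n : ℕ) :
    ℕ → (ℕ × ℕ → ℕ) → ℕ × ℕ → ℕ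
  | 0, T => T
  | k + 1, T => fjRun D (MJaux D S n k T) (cellOf D S (n - k))

/-- Modified jeu de taquin `MJ_S(T)`: perform forward jeu de taquin with the
entries of `T` in decreasing order of the labels `S` assigns to their cells. -/
noncomputable def MJ (D : Set (ℕ × ℕ)) (S T : ℕ × ℕ → ℕ) : ℕ × ℕ → ℕ :=
  MJaux D S D.ncard D.ncard T

/-- `FJaux D S₀ n k (T,S)`: perform forward jeu de taquin with the entries of the
first component in the cells labelled `n, n-1, …, n-k+1` in the fixed standard
tableau `S₀` (in this order), all transpositions being performed simultaneously
in the second component. -/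
noncomputable def FJaux (D : Set (ℕ × ℕ)) (S0 : ℕ × ℕ → ℕ) (n : ℕ) :
    ℕ → ((ℕ × ℕ → ℕ) × (ℕ × ℕ → ℕ)) → (ℕ × ℕ → ℕ) × (ℕ × ℕ → ℕ)
  | 0, p => p
  | k + 1, p => (fjIter D D.ncard (FJaux D S0 n k p) (cellOf D S0 (n - k))).1

/-- `FJ(T,S) = (S',T')`, where `T' = MJ_S(T)` and `S'` is obtained from `S` by
simultaneously performing all transpositions applied to `T` during modified
jeu de taquin with respect to `S`. -/
noncomputable def FJ (D : Set (ℕ × ℕ)) (T S : ℕ × ℕ → ℕ) :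
    (ℕ × ℕ → ℕ) × (ℕ × ℕ → ℕ) :=
  Prod.swap (FJaux D S D.ncard D.ncard (T, S))

/-- One step of backward jeu de taquin inside the subshape `E`: the cell whose
entry the moving entry at `c` is exchanged with (the larger of the left and
upper neighbours inside `E`, missing neighbours counting as `0`), provided such
a neighbour exists; `none` otherwise. -/
noncomputable def bjTarget (E : Set (ℕ × ℕ)) (f : ℕ × ℕ → ℕ) (c : ℕ × ℕ) :
    Option (ℕ × ℕ) :=
  let l := (c.1, c.2 - 1)
  let u := (c.1 - 1, c.2)
  let vl : ℕ := if 0 < c.2 ∧ l ∈ E then f l else 0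
  let vu : ℕ := if 0 < c.1 ∧ u ∈ E then f u else 0
  if (0 < c.2 ∧ l ∈ E) ∨ (0 < c.1 ∧ u ∈ E) then
    some (if vu ≤ vl then l else u)
  else none

/-- Iterated backward jeu de taquin inside the subshape `E` on a pair of
fillings, starting at cell `c`: the moves are driven by the first filling and
the exchanges are performed simultaneously in both fillings. -/
noncomputable def bjIter (E : Set (ℕ × ℕ)) :
    ℕ → ((ℕ × ℕ → ℕ) × (ℕ × ℕ → ℕ)) → ℕ × ℕ →
      ((ℕ × ℕ → ℕ) × (ℕ × ℕ → ℕ)) × (ℕ × ℕ)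
  | 0, p, c => (p, c)
  | fuel + 1, p, c =>
    match bjTarget E p.1 c with
    | none => (p, c)
    | some c' => bjIter E fuel (swapCells p.1 c c', swapCells p.2 c c') c'

/-- The elementary forward step `Jⁱ` on a pair `(T,S)`: forward jeu de taquin in
`T` with the entry lying in the cell labelled `i` in `S`, the transpositions
being performed simultaneously in `S`. -/
noncomputable def Jfwd (D : Set (ℕ × ℕ)) (i : ℕ)
    (p : (ℕ × ℕ → ℕ) × (ℕ × ℕ → ℕ)) : (ℕ × ℕ → ℕ) × (ℕ × ℕ → ℕ) :=
  (fjIter D D.ncard p (cellOf D p.2 i)).1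

/-- The elementary backward step `J_i` on a pair `(S',T')`: backward jeu de
taquin in `T'`, restricted to the subshape of cells whose entries in `S'` are
`≥ i`, with the entry of `T'` lying in the cell labelled `i` in `S'`, the
transpositions being performed simultaneously in `S'`. -/
noncomputable def Jbwd (D : Set (ℕ × ℕ)) (i : ℕ)
    (p : (ℕ × ℕ → ℕ) × (ℕ × ℕ → ℕ)) : (ℕ × ℕ → ℕ) × (ℕ × ℕ → ℕ) :=
  let q := (bjIter {c | c ∈ D ∧ i ≤ p.1 c} D.ncard (p.2, p.1) (cellOf D p.1 i)).1
  (q.2, q.1)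

/-- `BJaux D k (S',T')`: for `i = 1` to `k`, perform backward jeu de taquin in
the second component, restricted to the subshape of cells whose entries in the
current first component are `≥ i`, with the entry lying in the cell labelled
`i` in the current first component, all transpositions being performed
simultaneously in the first component. -/
noncomputable def BJaux (D : Set (ℕ × ℕ)) :
    ℕ → ((ℕ × ℕ → ℕ) × (ℕ × ℕ → ℕ)) → (ℕ × ℕ → ℕ) × (ℕ × ℕ → ℕ)
  | 0, p => p
  | i + 1, p =>
    let p' := BJaux D i p
    let q := (bjIter {c | c ∈ D ∧ i + 1 ≤ p'.1 c} D.ncard (p'.2, p'.1)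
      (cellOf D p'.1 (i + 1))).1
    (q.2, q.1)

/-- `BJ(S',T') = (T,S)`. -/
noncomputable def BJ (D : Set (ℕ × ℕ)) (S' T' : ℕ × ℕ → ℕ) :
    (ℕ × ℕ → ℕ) × (ℕ × ℕ → ℕ) :=
  Prod.swap (BJaux D D.ncard (S', T'))

/-- `JfwdList D [i₁,…,iₘ] p = Jⁱ¹(Jⁱ²(… (Jⁱᵐ p) …))`. -/
noncomputable def JfwdList (D : Set (ℕ × ℕ)) :
    List ℕ → ((ℕ × ℕ → ℕ) × (ℕ × ℕ → ℕ)) → (ℕ × ℕ → ℕ) × (ℕ × ℕ → ℕ)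
  | [], p => p
  | i :: rest, p => Jfwd D i (JfwdList D rest p)

/-- `JbwdList D [i₁,…,iₘ] p = J_{i₁}(J_{i₂}(… (J_{iₘ} p) …))`. -/
noncomputable def JbwdList (D : Set (ℕ × ℕ)) :
    List ℕ → ((ℕ × ℕ → ℕ) × (ℕ × ℕ → ℕ)) → (ℕ × ℕ → ℕ) × (ℕ × ℕ → ℕ)
  | [], p => p
  | i :: rest, p => Jbwd D i (JbwdList D rest p)

/-- `π` represents a permutation of `{1,…,n}` (it is the identity elsewhere). -/
def PermOn (n : ℕ) (π : Equiv.Perm ℕ) : Prop :=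
  ∀ i, i ∉ Set.Icc 1 n → π i = i

/-- `S_π`: the tabloid obtained from `S` by replacing every entry `i` by `π i`. -/
noncomputable def permApply (D : Set (ℕ × ℕ)) (π : Equiv.Perm ℕ)
    (S : ℕ × ℕ → ℕ) : ℕ × ℕ → ℕ :=
  fun c => if c ∈ D then π (S c) else 0

/-- Forward jeu de taquin in a single filling together with the list of cells
visited by the moving entry. -/
noncomputable def fjPath (D : Set (ℕ × ℕ)) :
    ℕ → (ℕ × ℕ → ℕ) → ℕ × ℕ → (ℕ × ℕ → ℕ) × List (ℕ × ℕ)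
  | 0, f, c => (f, [c])
  | fuel + 1, f, c =>
    match fjTarget D f c with
    | none => (f, [c])
    | some c' =>
      let q := fjPath D fuel (swapCells f c c') c'
      (q.1, c :: q.2)

/-- Backward jeu de taquin inside the subshape `E` in a single filling together
with the list of cells visited by the moving entry. -/
noncomputable def bjPath (E : Set (ℕ × ℕ)) :
    ℕ → (ℕ × ℕ → ℕ) → ℕ × ℕ → (ℕ × ℕ → ℕ) × List (ℕ × ℕ)
  | 0, f, c => (f, [c])
  | fuel + 1, f, c =>
    match bjTarget E f c with
    | none => (f, [c])
    | some c' =>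
      let q := bjPath E fuel (swapCells f c c') c'
      (q.1, c :: q.2)

/-- `y` is the right or the lower neighbour of `x`. -/
def CellEdge (x y : ℕ × ℕ) : Prop := y = (x.1, x.2 + 1) ∨ y = (x.1 + 1, x.2)

lemma CellEdge.ne {x y : ℕ × ℕ} (h : CellEdge x y) : x ≠ y := by
  rintro rfl
  rcases h with h | h <;> simp [Prod.ext_iff] at h

lemma CellEdge.asymm {x y : ℕ × ℕ} (h : CellEdge x y) : ¬ CellEdge y x := by
  intro h'
  rcases h with rfl | rfl <;> rcases h' with h' | h' <;> simp [Prod.ext_iff] at h' <;> omega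

/-- The local rule of the growth diagram. -/
def LocalRule (A B C E : Set (ℕ × ℕ)) : Prop :=
  (A = B ∧ C = E) ∨ (A = C ∧ B = E) ∨
  ∃ c x, c ≠ x ∧ c ∉ E ∧ x ∉ E ∧ A = insert c (insert x E) ∧
    ((CellEdge c x ∧ B = insert x E ∧ C = insert x E) ∨
     (¬ CellEdge c x ∧ ¬ CellEdge x c ∧ B = insert x E ∧ C = insert c E))

lemma LocalRule.symm {A B C E : Set (ℕ × ℕ)} (h : LocalRule A B C E) : LocalRule A C B E := by
  rcases h with h | h | ⟨c, x, hcx, hc, hx, hA, h | h⟩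
  · exact Or.inr (Or.inl h)
  · exact Or.inl h
  · exact Or.inr (Or.inr ⟨c, x, hcx, hc, hx, hA, Or.inl ⟨h.1, h.2.2, h.2.1⟩⟩)
  · exact Or.inr (Or.inr ⟨x, c, hcx.symm, hx, hc, by rw [hA, Set.insert_comm],
      Or.inr ⟨h.2.1, h.1, h.2.2.2, h.2.2.1⟩⟩)

lemma insert_inj_aux {α : Type*} {a b : α} {s : Set α} (ha : a ∉ s)
    (h : insert a s = insert b s) : a = b := by
  have : a ∈ insert b s := h ▸ Set.mem_insert a s
  rcases this with h | h
  · exact h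
  · exact absurd h ha

lemma insert_ne_aux {α : Type*} {a : α} {s : Set α} (ha : a ∉ s) : insert a s ≠ s := by
  intro h; exact ha (h ▸ Set.mem_insert a s)

lemma LocalRule.unique {A B C C' E : Set (ℕ × ℕ)} (h : LocalRule A B C E)
    (h' : LocalRule A B C' E) : C = C' := by
  have key : ∀ c x, c ≠ x → c ∉ E → x ∉ E → A = insert c (insert x E) → B = insert x E →
      A ≠ B ∧ B ≠ E := by
    intro c x hcx hc hx hA hB
    constructor
    · rw [hA, hB]; apply insert_ne_aux; simp [hcx, hc]
    · rw [hB]; exact insert_ne_aux hx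
  rcases h with h | h | ⟨c, x, hcx, hc, hx, hA, h⟩
  · rcases h' with h' | h' | ⟨c, x, hcx, hc, hx, hA, h'⟩
    · rw [h.2, h'.2]
    · rw [h.2, ← h'.1, h.1, h'.2]
    · exact absurd h.1 (key c x hcx hc hx hA (by tauto)).1
  · rcases h' with h' | h' | ⟨c, x, hcx, hc, hx, hA, h'⟩
    · rw [h'.2, ← h.1, h'.1, h.2]
    · rw [← h.1, h'.1]
    · exact absurd h.2 (key c x hcx hc hx hA (by tauto)).2
  · have hB : B = insert x E := by tauto
    have hk := key c x hcx hc hx hA hB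
    rcases h' with h' | h' | ⟨c', x', hcx', hc', hx', hA', h'⟩
    · exact absurd h'.1 hk.1
    · exact absurd h'.2 hk.2
    · have hB' : B = insert x' E := by tauto
      obtain rfl : x = x' := insert_inj_aux hx (hB ▸ hB')
      obtain rfl : c = c' := insert_inj_aux (by simp [hcx, hc]) (hA ▸ hA')
      rcases h with h | h <;> rcases h' with h' | h'
      · rw [h.2.2, h'.2.2]
      · exact absurd h.1 h'.1
      · exact absurd h'.1 h.1
      · rw [h.2.2.2, h'.2.2.2]

/-- Growth diagrams attached to the permutation `π`. -/
def GrowthDiag (n : ℕ) (π : Equiv.Perm ℕ) (G : ℕ → ℕ → Set (ℕ × ℕ)) : Prop :=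
  (∀ j, 1 ≤ j → j ≤ n + 1 → G (n + 1) j = ∅) ∧ (∀ i, 1 ≤ i → i ≤ n + 1 → G i (n + 1) = ∅) ∧
  ∀ i j, 1 ≤ i → i ≤ n → 1 ≤ j → j ≤ n →
    (π i = j → G i (j + 1) = G (i + 1) (j + 1) ∧ G (i + 1) j = G (i + 1) (j + 1)) ∧
    (π i ≠ j → LocalRule (G i j) (G (i + 1) j) (G i (j + 1)) (G (i + 1) (j + 1)))

lemma GrowthDiag.transpose {n : ℕ} {π : Equiv.Perm ℕ} {G : ℕ → ℕ → Set (ℕ × ℕ)}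
    (h : GrowthDiag n π G) : GrowthDiag n π.symm (fun i j => G j i) := by
  refine ⟨h.2.1, h.1, fun i j hi hi' hj hj' => ?_⟩
  have := h.2.2 j i hj hj' hi hi'
  constructor
  · intro hij
    have h1 := this.1 (by rw [← hij]; simp)
    exact ⟨h1.2, h1.1⟩
  · intro hij
    exact (this.2 (fun h => hij (by rw [← h]; simp))).symm

lemma GrowthDiag.unique {n : ℕ} {π : Equiv.Perm ℕ} {G G' : ℕ → ℕ → Set (ℕ × ℕ)}
    (h : GrowthDiag n π G) (h' : GrowthDiag n π G')
    (h1 : ∀ i, 1 ≤ i → i ≤ n + 1 → G i 1 = G' i 1) :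
    ∀ k i, i + k = n + 1 → 1 ≤ i → ∀ j, j ≤ n → G i (j + 1) = G' i (j + 1) := by
  intro k
  induction k with
  | zero =>
    intro i hi _ j hj
    obtain rfl : i = n + 1 := by omega
    rw [h.1 _ (by omega) (by omega), h'.1 _ (by omega) (by omega)]
  | succ k ih =>
    intro i hi hi1 j
    have ih' := ih (i + 1) (by omega) (by omega)
    induction j with
    | zero => intro _; exact h1 i hi1 (by omega)
    | succ j ihj =>
      intro hj
      have a := h.2.2 i (j + 1) hi1 (by omega) (by omega) (by omega)
      have a' := h'.2.2 i (j + 1) hi1 (by omega) (by omega) (by omega)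
      by_cases hπ : π i = j + 1
      · rw [(a.1 hπ).1, (a'.1 hπ).1, ih' _ hj]
      · have r := a.2 hπ
        have r' := a'.2 hπ
        rw [ihj (by omega), ih' _ hj, ih' j (by omega)] at r
        exact r.unique r'

lemma fjTarget_none {D : Set (ℕ × ℕ)} {f : ℕ × ℕ → ℕ} {c : ℕ × ℕ} (hc : c ∈ D)
    (h : fjTarget D f c = none) : ∀ y ∈ D, CellEdge c y → f c ≤ f y := by
  intro y hy hcy
  unfold fjTarget at h
  simp only [ite_eq_right_iff, reduceCtorEq, imp_false, not_lt, le_min_iff] at h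
  unfold jval at h
  rw [if_pos hc] at h
  rcases hcy with rfl | rfl
  · have := h.1
    rw [if_pos hy] at this
    exact_mod_cast this
  · have := h.2
    rw [if_pos hy] at this
    exact_mod_cast this

lemma fjTarget_some {D : Set (ℕ × ℕ)} {f : ℕ × ℕ → ℕ} {c c' : ℕ × ℕ} (hc : c ∈ D)
    (h : fjTarget D f c = some c') : c' ∈ D ∧ CellEdge c c' ∧ f c' < f c ∧
      ∀ y ∈ D, CellEdge c y → f c' ≤ f y := by
  have key : CellEdge c c' ∧ jval D f c' < jval D f c ∧
      ∀ y, CellEdge c y → jval D f c' ≤ jval D f y := by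
    unfold fjTarget at h
    simp only [Option.ite_none_right_eq_some, Option.some.injEq] at h
    obtain ⟨h1, h2⟩ := h
    split_ifs at h2 with h3
    · subst h2
      rw [min_eq_left h3] at h1
      refine ⟨Or.inl rfl, h1, ?_⟩
      rintro y (rfl | rfl)
      · exact le_rfl
      · exact h3
    · subst h2
      push Not at h3
      rw [min_eq_right h3.le] at h1
      refine ⟨Or.inr rfl, h1, ?_⟩
      rintro y (rfl | rfl)
      · exact h3.le
      · exact le_rfl
  obtain ⟨h1, h2, h3⟩ := key
  have hc' : c' ∈ D := by
    by_contra hn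
    simp [jval, hn] at h2
  refine ⟨hc', h1, ?_, ?_⟩
  · simpa [jval, hc, hc'] using h2
  · intro y hy hcy
    simpa [jval, hy, hc'] using h3 y hcy

/-- Cells of `W` with entries at least `j`. -/
def levSet (W : Set (ℕ × ℕ)) (h : ℕ × ℕ → ℕ) (j : ℕ) : Set (ℕ × ℕ) := {x | x ∈ W ∧ j ≤ h x}

/-- Cells of `W` except `c` with entries at least `j`. -/
def levSetC (W : Set (ℕ × ℕ)) (c : ℕ × ℕ) (h : ℕ × ℕ → ℕ) (j : ℕ) : Set (ℕ × ℕ) :=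
  {x | x ∈ W ∧ x ≠ c ∧ j ≤ h x}

/-- Invariant of a forward slide. -/
structure SlideInv (D W : Set (ℕ × ℕ)) (n e : ℕ) (h : ℕ × ℕ → ℕ) (c : ℕ × ℕ) (w : ℕ) : Prop where
  sub : W ⊆ D
  up : ∀ x ∈ W, ∀ y ∈ D, CellEdge x y → y ∈ W
  mem : c ∈ W
  val : h c = e
  lt : w < e
  inj : Set.InjOn h D
  le : ∀ x ∈ D, h x ≤ n
  pred : ∀ x ∈ W, CellEdge x c → h x ≤ w
  succ : ∀ y ∈ W, CellEdge c y → w < h y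
  inc : ∀ x ∈ W, ∀ y ∈ W, x ≠ c → y ≠ c → CellEdge x y → h x < h y

/-- Result of a forward slide. -/
structure SlidePost (D W : Set (ℕ × ℕ)) (e : ℕ) (h : ℕ × ℕ → ℕ) (c : ℕ × ℕ) (w : ℕ)
    (g : ℕ × ℕ → ℕ) : Prop where
  perm : ∃ σ : Equiv.Perm (ℕ × ℕ), g = h ∘ σ ∧ ∀ x, x ∉ W → σ x = x
  inc : ∀ x ∈ W, ∀ y ∈ W, CellEdge x y → g x < g y
  low : ∀ j, j ≤ w + 1 → levSet W g j = levSet W h j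
  rule : ∀ j, w < j → j ≠ e →
    LocalRule (levSet W g j) (levSetC W c h j) (levSet W g (j + 1)) (levSetC W c h (j + 1))
  eqn : levSet W g (e + 1) = levSetC W c h (e + 1) ∧ levSetC W c h e = levSetC W c h (e + 1)

/-- Rule for a value which does not interact with the moving entry. -/
lemma rule_basic {D W : Set (ℕ × ℕ)} {n e : ℕ} {h : ℕ × ℕ → ℕ} {c : ℕ × ℕ} {w j : ℕ}
    (I : SlideInv D W n e h c w) (hj : w < j) (hje : j < e)
    (hs : ∀ y ∈ W, CellEdge c y → h y ≠ j) :
    LocalRule (levSet W h j) (levSetC W c h j) (levSet W h (j + 1)) (levSetC W c h (j + 1)) := by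
  have hval := I.val
  by_cases hx : ∃ x ∈ W, h x = j
  · obtain ⟨x, hxW, hxj⟩ := hx
    have hxc : x ≠ c := by rintro rfl; omega
    have hinj : ∀ y ∈ W, h y = j → y = x := fun y hy hyj =>
      I.inj (I.sub hy) (I.sub hxW) (by rw [hyj, hxj])
    have hmem := I.mem
    refine Or.inr (Or.inr ⟨c, x, hxc.symm, ?_, ?_, ?_, Or.inr ⟨?_, ?_, ?_, ?_⟩⟩)
    · simp [levSetC]
    · simp [levSetC, hxj]
    · ext y
      simp only [levSet, levSetC, Set.mem_ofPred_eq, Set.mem_insert_iff]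
      grind
    · intro hcx; exact hs x hxW hcx hxj
    · intro hxc'; have := I.pred x hxW hxc'; omega
    · ext y
      simp only [levSet, levSetC, Set.mem_ofPred_eq, Set.mem_insert_iff]
      grind
    · ext y
      simp only [levSet, levSetC, Set.mem_ofPred_eq, Set.mem_insert_iff]
      grind
  · push Not at hx
    refine Or.inr (Or.inl ⟨?_, ?_⟩) <;> ext y <;>
      simp only [levSet, levSetC, Set.mem_ofPred_eq] <;> grind

lemma eqn_aux {D W : Set (ℕ × ℕ)} {n e : ℕ} {h : ℕ × ℕ → ℕ} {c : ℕ × ℕ} {w : ℕ}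
    (I : SlideInv D W n e h c w) : levSetC W c h e = levSetC W c h (e + 1) := by
  ext y
  simp only [levSetC, Set.mem_ofPred_eq]
  constructor
  · rintro ⟨h1, h2, h3⟩
    refine ⟨h1, h2, ?_⟩
    have : h y ≠ e := fun h4 => h2 (I.inj (I.sub h1) (I.sub I.mem) (by rw [h4, I.val]))
    omega
  · rintro ⟨h1, h2, h3⟩
    exact ⟨h1, h2, by omega⟩

lemma swapCells_eq (f : ℕ × ℕ → ℕ) (a b : ℕ × ℕ) :
    swapCells f a b = f ∘ (Equiv.swap a b) := by
  funext x
  simp only [swapCells, Function.update_apply, Function.comp, Equiv.swap_apply_def]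
  split_ifs <;> simp_all

lemma slide_main (D W : Set (ℕ × ℕ)) (n e : ℕ) : ∀ (fuel : ℕ) (h h2 : ℕ × ℕ → ℕ) (c : ℕ × ℕ) (w : ℕ),
    n ≤ fuel + w → SlideInv D W n e h c w →
    SlidePost D W e h c w ((fjIter D fuel (h, h2) c).1).1 := by
  intro fuel
  induction fuel with
  | zero =>
    intro h h2 c w hn I
    have := I.le c (I.sub I.mem)
    have := I.val
    have := I.lt
    omega
  | succ fuel ih =>
    intro h h2 c w hn I
    have hval := I.val
    have hlt := I.lt
    have hmem := I.mem
    simp only [fjIter]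
    split
    · rename_i hnone
      have hs := fjTarget_none (I.sub I.mem) hnone
      have hs' : ∀ y ∈ W, CellEdge c y → e < h y := by
        intro y hy hcy
        have h1 := hs y (I.sub hy) hcy
        have h2 : h c ≠ h y := fun h3 => hcy.ne (I.inj (I.sub I.mem) (I.sub hy) h3)
        omega
      refine ⟨⟨1, rfl, fun _ _ => rfl⟩, ?_, fun _ _ => rfl, ?_, ?_, eqn_aux I⟩
      · intro x hx y hy hxy
        change h x < h y
        by_cases hxc : x = c
        · subst hxc; rw [hval]; exact hs' y hy hxy
        by_cases hyc : y = c
        · subst hyc; have := I.pred x hx hxy; omega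
        exact I.inc x hx y hy hxc hyc hxy
      · intro j hj hje
        rcases lt_or_gt_of_ne hje with hje | hje
        · refine rule_basic (h := h) I hj hje (fun y hy hcy => ?_)
          have := hs' y hy hcy
          change h y ≠ j
          omega
        · left
          constructor <;> ext y <;> simp only [levSet, levSetC, Set.mem_ofPred_eq] <;> grind
      · ext y; simp only [levSet, levSetC, Set.mem_ofPred_eq]; grind
    · rename_i c' hsome
      obtain ⟨hc'D, hcc', hv, hmin⟩ := fjTarget_some (I.sub I.mem) hsome
      have hc'W := I.up c I.mem c' hc'D hcc'
      have hne := hcc'.ne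
      set h1 := swapCells h c c' with hh1
      have e1 : h1 c = h c' := by simp [hh1, swapCells, Function.update_apply, hne]
      have e2 : h1 c' = h c := by simp [hh1, swapCells]
      have e3 : ∀ x, x ≠ c → x ≠ c' → h1 x = h x := by
        intro x hx hx'; simp [hh1, swapCells, Function.update_apply, hx, hx']
      have hwv := I.succ c' hc'W hcc'
      have hmin' : ∀ y ∈ W, y ≠ c' → CellEdge c y → h c' < h y := by
        intro y hy hyc hcy
        have a := hmin y (I.sub hy) hcy
        have b : h c' ≠ h y := fun h3 => hyc (I.inj hc'D (I.sub hy) h3).symm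
        omega
      have I1 : SlideInv D W n e h1 c' (h c') := by
        refine ⟨I.sub, I.up, hc'W, by rw [e2, hval], by omega, ?_, ?_, ?_, ?_, ?_⟩
        · rw [hh1, swapCells_eq]
          intro x hx y hy hxy
          have m : ∀ z ∈ D, Equiv.swap c c' z ∈ D := by
            intro z hz
            rw [Equiv.swap_apply_def]
            have := I.sub I.mem
            split_ifs <;> assumption
          exact (Equiv.swap c c').injective (I.inj (m x hx) (m y hy) hxy)
        · intro x hx
          by_cases hxc : x = c
          · rw [hxc, e1]; exact I.le _ hc'D
          by_cases hxc' : x = c'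
          · rw [hxc', e2]; exact I.le _ (I.sub I.mem)
          rw [e3 x hxc hxc']; exact I.le _ hx
        · intro x hx hxc'
          by_cases hxc : x = c
          · rw [hxc, e1]
          rw [e3 x hxc hxc'.ne]
          exact (I.inc x hx c' hc'W hxc hne.symm hxc').le
        · intro y hy hc'y
          have hyc : y ≠ c := by rintro rfl; exact hcc'.asymm hc'y
          rw [e3 y hyc hc'y.ne.symm]
          exact I.inc c' hc'W y hy hne.symm hyc hc'y
        · intro x hx y hy hxc' hyc' hxy
          by_cases hxc : x = c
          · subst hxc
            rw [e1, e3 y hxy.ne.symm hyc']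
            exact hmin' y hy hyc' hxy
          rw [e3 x hxc hxc']
          by_cases hyc : y = c
          · subst hyc
            rw [e1]
            have := I.pred x hx hxy
            omega
          rw [e3 y hyc hyc']
          exact I.inc x hx y hy hxc hyc hxy
      have post := ih h1 (swapCells h2 c c') c' (h c') (by omega) I1
      set g := ((fjIter D fuel (h1, swapCells h2 c c') c').1).1 with hg
      have lv : ∀ j, j ≤ h c' → levSet W h1 j = levSet W h j := by
        intro j hj
        ext y
        simp only [levSet, Set.mem_ofPred_eq]
        by_cases hyc : y = c
        · subst hyc; rw [e1]; grind
        by_cases hyc' : y = c'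
        · subst hyc'; rw [e2]; grind
        rw [e3 y hyc hyc']
      have lc : ∀ j, h c' < j → levSetC W c' h1 j = levSetC W c h j := by
        intro j hj
        ext y
        simp only [levSetC, Set.mem_ofPred_eq]
        by_cases hyc : y = c
        · subst hyc; rw [e1]; grind
        by_cases hyc' : y = c'
        · subst hyc'; grind
        rw [e3 y hyc hyc']; simp [hyc, hyc']
      have lg : ∀ j, j ≤ h c' → levSet W g j = levSet W h j := fun j hj =>
        (post.low j (by omega)).trans (lv j hj)
      refine ⟨?_, post.inc, fun j hj => lg j (by omega), ?_, ?_, eqn_aux I⟩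
      · obtain ⟨σ, hσ, hσ'⟩ := post.perm
        refine ⟨σ.trans (Equiv.swap c c'), ?_, ?_⟩
        · rw [hσ, hh1, swapCells_eq]; rfl
        · intro x hx
          simp only [Equiv.trans_apply, hσ' x hx]
          exact Equiv.swap_apply_of_ne_of_ne (by rintro rfl; exact hx hmem)
            (by rintro rfl; exact hx hc'W)
      · intro j hj hje
        rcases lt_trichotomy j (h c') with hjv | hjv | hjv
        · rw [lg j hjv.le, lg (j + 1) hjv]
          refine rule_basic I hj (by omega) ?_
          intro y hy hcy
          have := hmin y (I.sub hy) hcy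
          omega
        · rw [lg j hjv.le, post.low (j + 1) (by omega)]
          have hinj : ∀ y ∈ W, h y = j → y = c' := fun y hy hyj =>
            I.inj (I.sub hy) hc'D (by rw [hyj, hjv])
          refine Or.inr (Or.inr ⟨c, c', hne, ?_, ?_, ?_, Or.inl ⟨hcc', ?_, ?_⟩⟩)
          · simp [levSetC]
          · simp [levSetC, hjv]
          · ext y
            simp only [levSet, levSetC, Set.mem_ofPred_eq, Set.mem_insert_iff]
            grind
          · ext y
            simp only [levSet, levSetC, Set.mem_ofPred_eq, Set.mem_insert_iff]
            grind
          · ext y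
            simp only [levSet, levSetC, Set.mem_ofPred_eq, Set.mem_insert_iff]
            by_cases hyc : y = c
            · subst hyc; rw [e1]; grind
            by_cases hyc' : y = c'
            · subst hyc'; rw [e2]; grind
            rw [e3 y hyc hyc']; simp [hyc, hyc']
        · have := post.rule j hjv hje
          rwa [lc j hjv, lc (j + 1) (by omega)] at this
      · rw [post.eqn.1, lc _ (by omega)]

lemma cellOf_spec {D : Set (ℕ × ℕ)} {P : ℕ × ℕ → ℕ} (hP : IsStandard D P) {i : ℕ}
    (h1 : 1 ≤ i) (h2 : i ≤ D.ncard) : cellOf D P i ∈ D ∧ P (cellOf D P i) = i := by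
  obtain ⟨c, hc, hci⟩ := hP.1.1.surjOn (show i ∈ Set.Icc 1 D.ncard from ⟨h1, h2⟩)
  exact Classical.epsilon_spec (p := fun c => c ∈ D ∧ P c = i) ⟨c, hc, hci⟩

lemma IsTabloid.comp_perm {D W : Set (ℕ × ℕ)} {f : ℕ × ℕ → ℕ} (hf : IsTabloid D f) (hW : W ⊆ D)
    (σ : Equiv.Perm (ℕ × ℕ)) (hσ : ∀ x, x ∉ W → σ x = x) : IsTabloid D (f ∘ σ) := by
  have hσD : ∀ x, x ∉ D → σ x = x := fun x hx => hσ x (fun h => hx (hW h))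
  refine ⟨hf.1.comp ⟨?_, σ.injective.injOn, ?_⟩, ?_⟩
  · intro x hx
    by_contra hn
    have h1 := hσD _ hn
    have h2 := σ.injective h1
    rw [h2] at hn
    exact hn hx
  · intro y hy
    refine ⟨σ.symm y, ?_, by simp⟩
    by_contra hn
    have h1 := hσD _ hn
    simp only [Equiv.apply_symm_apply] at h1
    rw [← h1] at hn
    exact hn hy
  · intro x hx
    simp only [Function.comp, hσD x hx]
    exact hf.2 x hx

lemma permApply_tabloid {D : Set (ℕ × ℕ)} {P : ℕ × ℕ → ℕ} (hP : IsTabloid D P)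
    {π : Equiv.Perm ℕ} (hπ : PermOn D.ncard π) : IsTabloid D (permApply D π P) := by
  constructor
  · have hb : Set.BijOn π (Set.Icc 1 D.ncard) (Set.Icc 1 D.ncard) := by
      refine ⟨?_, π.injective.injOn, ?_⟩
      · intro x hx
        by_contra hn
        have h2 := π.injective (hπ _ hn)
        rw [h2] at hn
        exact hn hx
      · intro y hy
        refine ⟨π.symm y, ?_, by simp⟩
        by_contra hn
        have h1 := hπ _ hn
        simp only [Equiv.apply_symm_apply] at h1
        rw [← h1] at hn
        exact hn hy
    refine (hb.comp hP.1).congr ?_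
    intro x hx
    simp [permApply, hx]
  · intro c hc
    simp [permApply, hc]

/-- The cells with labels at least `i` in `P`. -/
def upSet (D : Set (ℕ × ℕ)) (P : ℕ × ℕ → ℕ) (i : ℕ) : Set (ℕ × ℕ) := {c | c ∈ D ∧ i ≤ P c}

lemma mj_step {D : Set (ℕ × ℕ)} {P f : ℕ × ℕ → ℕ} (hP : IsStandard D P) (hf : IsTabloid D f)
    {i e : ℕ} (hi : 1 ≤ i) (hin : i ≤ D.ncard)
    (hinc : ∀ x ∈ upSet D P (i + 1), ∀ y ∈ upSet D P (i + 1), CellEdge x y → f x < f y)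
    (he : f (cellOf D P i) = e) :
    SlidePost D (upSet D P i) e f (cellOf D P i) 0 (fjRun D f (cellOf D P i)) := by
  obtain ⟨hc, hci⟩ := cellOf_spec hP hi hin
  set c := cellOf D P i
  have hPe : ∀ x ∈ D, ∀ y ∈ D, CellEdge x y → P x < P y := by
    intro x hx y hy hxy
    rcases hxy with rfl | rfl
    · exact (hP.2 x hx).1 hy
    · exact (hP.2 x hx).2 hy
  have hPi : ∀ x ∈ D, P x = i → x = c := fun x hx h =>
    hP.1.1.injOn hx hc (by rw [h, hci])
  have hmaps : ∀ x ∈ D, 1 ≤ f x ∧ f x ≤ D.ncard := fun x hx => hf.1.mapsTo hx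
  have hup : ∀ x ∈ upSet D P i, x ≠ c → x ∈ upSet D P (i + 1) := by
    intro x hx hxc
    refine ⟨hx.1, ?_⟩
    have h1 := hx.2
    have : P x ≠ i := fun h => hxc (hPi x hx.1 h)
    omega
  apply slide_main D (upSet D P i) D.ncard e D.ncard f f c 0 (by omega)
  refine ⟨fun x hx => hx.1, ?_, ⟨hc, hci.ge⟩, he, ?_, hf.1.injOn, fun x hx => (hmaps x hx).2,
    ?_, ?_, ?_⟩
  · intro x hx y hy hxy
    exact ⟨hy, hx.2.trans (hPe x hx.1 y hy hxy).le⟩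
  · have := hmaps c hc; omega
  · intro x hx hxc
    have h1 := hPe x hx.1 c hc hxc
    have h2 := hx.2
    omega
  · intro y hy _
    have := hmaps y hy.1; omega
  · intro x hx y hy hxc hyc hxy
    exact hinc x (hup x hx hxc) y (hup y hy hyc) hxy

lemma mjaux_inv {D : Set (ℕ × ℕ)} {P : ℕ × ℕ → ℕ} (hP : IsStandard D P)
    {π : Equiv.Perm ℕ} (hπ : PermOn D.ncard π) :
    ∀ k i, i + k = D.ncard + 1 → 1 ≤ i →
      IsTabloid D (MJaux D P D.ncard k (permApply D π P)) ∧
      (∀ x ∈ upSet D P i, ∀ y ∈ upSet D P i, CellEdge x y →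
        MJaux D P D.ncard k (permApply D π P) x < MJaux D P D.ncard k (permApply D π P) y) ∧
      (∀ x ∈ D, P x < i → MJaux D P D.ncard k (permApply D π P) x = π (P x)) := by
  intro k
  induction k with
  | zero =>
    intro i hi _
    refine ⟨permApply_tabloid hP.1 hπ, ?_, ?_⟩
    · intro x hx
      have h1 := hx.2
      have h2 := (hP.1.1.mapsTo hx.1).2
      omega
    · intro x hx _
      simp [MJaux, permApply, hx]
  | succ k ih =>
    intro i hi hi1
    obtain ⟨h1, h2, h3⟩ := ih (i + 1) (by omega) (by omega)
    have hk : D.ncard - k = i := by omega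
    have post := mj_step hP h1 hi1 (by omega) h2 rfl
    simp only [MJaux, hk]
    refine ⟨?_, post.inc, ?_⟩
    · obtain ⟨σ, hσ, hσ'⟩ := post.perm
      rw [hσ]
      exact h1.comp_perm (fun x hx => hx.1) σ hσ'
    · intro x hx hxi
      obtain ⟨σ, hσ, hσ'⟩ := post.perm
      rw [hσ]
      simp only [Function.comp]
      rw [hσ' x (fun h => by have := h.2; omega)]
      exact h3 x hx (by omega)

/-- The growth diagram of modified jeu de taquin. -/
noncomputable def mjG (D : Set (ℕ × ℕ)) (P : ℕ × ℕ → ℕ) (π : Equiv.Perm ℕ) (i j : ℕ) :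
    Set (ℕ × ℕ) :=
  levSet (upSet D P i) (MJaux D P D.ncard (D.ncard + 1 - i) (permApply D π P)) j

lemma mjG_growth {D : Set (ℕ × ℕ)} {P : ℕ × ℕ → ℕ} (hP : IsStandard D P)
    {π : Equiv.Perm ℕ} (hπ : PermOn D.ncard π) : GrowthDiag D.ncard π (mjG D P π) := by
  refine ⟨?_, ?_, ?_⟩
  · intro j _ _
    ext x
    simp only [mjG, levSet, upSet, Set.mem_ofPred_eq, Set.mem_empty_iff_false, iff_false]
    rintro ⟨⟨hx, h1⟩, _⟩
    have h2 := (hP.1.1.mapsTo hx).2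
    omega
  · intro i h1 h2
    ext x
    simp only [mjG, levSet, Set.mem_ofPred_eq, Set.mem_empty_iff_false, iff_false]
    rintro ⟨hx, h3⟩
    have h4 := ((mjaux_inv hP hπ (D.ncard + 1 - i) i (by omega) h1).1.1.mapsTo hx.1).2
    omega
  · intro i j hi hin hj hjn
    obtain ⟨h1, h2, h3⟩ := mjaux_inv hP hπ (D.ncard - i) (i + 1) (by omega) (by omega)
    obtain ⟨hc, hci⟩ := cellOf_spec hP hi hin
    have he := h3 _ hc (by omega)
    rw [hci] at he
    have post := mj_step hP h1 hi hin h2 he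
    have g1 : ∀ j, mjG D P π i j = levSet (upSet D P i)
        (fjRun D (MJaux D P D.ncard (D.ncard - i) (permApply D π P)) (cellOf D P i)) j := by
      intro j
      have a : D.ncard + 1 - i = (D.ncard - i) + 1 := by omega
      have b : D.ncard - (D.ncard - i) = i := by omega
      rw [mjG, a, MJaux, b]
    have g2 : ∀ j, mjG D P π (i + 1) j = levSetC (upSet D P i) (cellOf D P i)
        (MJaux D P D.ncard (D.ncard - i) (permApply D π P)) j := by
      intro j
      have a : D.ncard + 1 - (i + 1) = D.ncard - i := by omega
      rw [mjG, a]
      ext x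
      simp only [levSet, levSetC, upSet, Set.mem_ofPred_eq]
      constructor
      · rintro ⟨⟨hx, hx1⟩, hx2⟩
        refine ⟨⟨hx, by omega⟩, ?_, hx2⟩
        intro hxc
        rw [hxc] at hx1
        omega
      · rintro ⟨⟨hx, hx1⟩, hx2, hx3⟩
        refine ⟨⟨hx, ?_⟩, hx3⟩
        have : P x ≠ i := fun h => hx2 (hP.1.1.injOn hx hc (by rw [h, hci]))
        omega
    rw [g1, g1, g2, g2]
    constructor
    · rintro rfl
      exact post.eqn
    · intro hne
      exact post.rule j (by omega) (fun h => hne h.symm)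

lemma mjG_col {D : Set (ℕ × ℕ)} {P : ℕ × ℕ → ℕ} (hP : IsStandard D P)
    {π : Equiv.Perm ℕ} (hπ : PermOn D.ncard π) (i : ℕ) (h1 : 1 ≤ i) (h2 : i ≤ D.ncard + 1) :
    mjG D P π i 1 = upSet D P i := by
  ext x
  simp only [mjG, levSet, Set.mem_ofPred_eq, and_iff_left_iff_imp]
  intro hx
  exact ((mjaux_inv hP hπ (D.ncard + 1 - i) i (by omega) h1).1.1.mapsTo hx.1).1

lemma mjG_row {D : Set (ℕ × ℕ)} {P : ℕ × ℕ → ℕ} (hP : IsStandard D P)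
    {π : Equiv.Perm ℕ} (j : ℕ) :
    mjG D P π 1 j = upSet D (MJ D P (permApply D π P)) j := by
  ext x
  simp only [mjG, levSet, upSet, Set.mem_ofPred_eq, MJ, Nat.add_sub_cancel]
  constructor
  · rintro ⟨⟨a, _⟩, b⟩; exact ⟨a, b⟩
  · rintro ⟨a, b⟩; exact ⟨⟨a, (hP.1.1.mapsTo a).1⟩, b⟩

lemma mj_symm_aux {D : Set (ℕ × ℕ)} {P Q : ℕ × ℕ → ℕ}
    (hP : IsStandard D P) (hQ : IsStandard D Q)
    {π : Equiv.Perm ℕ} (hπ : PermOn D.ncard π) (h : MJ D P (permApply D π P) = Q) :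
    MJ D Q (permApply D π.symm Q) = P := by
  have hπ' : PermOn D.ncard π.symm := by
    intro i hi
    rw [Equiv.symm_apply_eq]
    exact (hπ i hi).symm
  have G1 := (mjG_growth hP hπ).transpose
  have G2 := mjG_growth hQ hπ'
  have hu := GrowthDiag.unique G2 G1 (by
    intro i h1 h2
    rw [mjG_col hQ hπ' i h1 h2, mjG_row hP, h]) D.ncard 1 (by omega) le_rfl
  have htab : IsTabloid D (MJ D Q (permApply D π.symm Q)) :=
    (mjaux_inv hQ hπ' D.ncard 1 (by omega) le_rfl).1
  have key : ∀ x ∈ D, ∀ j, j ≤ D.ncard →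
      (j + 1 ≤ MJ D Q (permApply D π.symm Q) x ↔ j + 1 ≤ P x) := by
    intro x hx j hj
    have a := hu j hj
    rw [mjG_row hQ, mjG_col hP hπ (j + 1) (by omega) (by omega)] at a
    have b := Set.ext_iff.1 a x
    simpa [upSet, hx] using b
  funext x
  by_cases hx : x ∈ D
  · have a1 := htab.1.mapsTo hx
    have a2 := hP.1.1.mapsTo hx
    obtain ⟨b1, b2⟩ := a1
    obtain ⟨c1, c2⟩ := a2
    have k1 := key x hx (MJ D Q (permApply D π.symm Q) x - 1) (by omega)
    have k2 := key x hx (P x - 1) (by omega)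
    omega
  · rw [htab.2 x hx, hP.1.2 x hx]

/-- Theorem 1, symmetry theorem: for standard skew tableaux
`P, Q` of the same (shifted or unshifted) skew shape and a permutation `π` of
`{1,…,n}`, `MJ_P(P_π) = Q` if and only if `MJ_Q(Q_{π⁻¹}) = P`. -/
theorem mj_symmetry (sh : SkewShape) (P Q : ℕ × ℕ → ℕ)
    (hP : IsStandard sh.cells P) (hQ : IsStandard sh.cells Q)
    (π : Equiv.Perm ℕ) (hπ : PermOn sh.cells.ncard π) :
    MJ sh.cells P (permApply sh.cells π P) = Q ↔
      MJ sh.cells Q (permApply sh.cells π.symm Q) = P := by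
  have hπ' : PermOn sh.cells.ncard π.symm := by
    intro i hi
    rw [Equiv.symm_apply_eq]
    exact (hπ i hi).symm
  constructor
  · exact mj_symm_aux hP hQ hπ
  · intro h
    simpa using mj_symm_aux hQ hP hπ' h
end

section
/- Let μ/λ be a fixed (shifted or unshifted) skew shape and let P, Q be two standard skew tableaux of shape μ/λ. Then A_{P,Q} = A_{Q,P}, where A_{P,Q} denotes the number of tabloids T of shape μ/λ with MJ_P(T) = Q. -/
open scoped Classical

/-! ### Proof -/

/-- Filling of the grid. -/
abbrev Fil := ℕ × ℕ → ℕ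

/-- `b` is the right or lower neighbour of `a`. -/
def Nb (a b : ℕ × ℕ) : Prop := b = (a.1, a.2 + 1) ∨ b = (a.1 + 1, a.2)

/-- The values `m`, `m+1` occupy neighbouring cells. -/
def AdjVals (D : Set (ℕ × ℕ)) (m : ℕ) (f : Fil) : Prop :=
  ∃ a ∈ D, ∃ b ∈ D, Nb a b ∧ ((f a = m ∧ f b = m + 1) ∨ (f a = m + 1 ∧ f b = m))

theorem swap_eq_left_iff (m x : ℕ) : Equiv.swap m (m + 1) x = m ↔ x = m + 1 := by
  rw [Equiv.swap_apply_eq_iff]; simp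

theorem swap_eq_right_iff (m x : ℕ) : Equiv.swap m (m + 1) x = m + 1 ↔ x = m := by
  rw [Equiv.swap_apply_eq_iff]; simp

theorem adjVals_swap (D : Set (ℕ × ℕ)) (m : ℕ) (f : Fil) :
    AdjVals D m (Equiv.swap m (m + 1) ∘ f) ↔ AdjVals D m f := by
  unfold AdjVals
  simp only [Function.comp, swap_eq_left_iff, swap_eq_right_iff]
  constructor
  · rintro ⟨a, ha, b, hb, h, h'⟩; exact ⟨a, ha, b, hb, h, h'.symm⟩
  · rintro ⟨a, ha, b, hb, h, h'⟩; exact ⟨a, ha, b, hb, h, h'.symm⟩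

theorem swap_eq_far (m k x y : ℕ) (h : y ≠ m) (h' : y ≠ m + 1) :
    Equiv.swap m (m + 1) x = y ↔ x = y := by
  rw [Equiv.swap_apply_eq_iff, Equiv.swap_apply_of_ne_of_ne h h']

theorem adjVals_swap_far (D : Set (ℕ × ℕ)) (m k : ℕ) (hk : m + 2 ≤ k ∨ k + 2 ≤ m) (f : Fil) :
    AdjVals D k (Equiv.swap m (m + 1) ∘ f) ↔ AdjVals D k f := by
  unfold AdjVals
  simp only [Function.comp]
  simp only [swap_eq_far m k _ k (by omega) (by omega),
    swap_eq_far m k _ (k + 1) (by omega) (by omega)]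

/-- The toggle as a map. -/
noncomputable def togFun (D : Set (ℕ × ℕ)) (m : ℕ) (f : Fil) : Fil :=
  if AdjVals D m f then f else Equiv.swap m (m + 1) ∘ f

theorem togFun_invol (D : Set (ℕ × ℕ)) (m : ℕ) : Function.Involutive (togFun D m) := by
  intro f
  unfold togFun
  by_cases h : AdjVals D m f
  · simp [h]
  · rw [if_neg h, if_neg (by rwa [adjVals_swap])]
    funext c; simp

/-- The toggle as a permutation of fillings. -/
noncomputable def tog (D : Set (ℕ × ℕ)) (m : ℕ) : Equiv.Perm Fil :=
  (togFun_invol D m).toPerm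

theorem tog_apply (D : Set (ℕ × ℕ)) (m : ℕ) (f : Fil) :
    tog D m f = if AdjVals D m f then f else Equiv.swap m (m + 1) ∘ f := rfl

theorem swap_far_comm (m k : ℕ) (hk : m + 2 ≤ k) :
    Commute (Equiv.swap m (m + 1)) (Equiv.swap k (k + 1)) := by
  apply Equiv.Perm.Disjoint.commute
  intro x
  by_cases h : x = m ∨ x = m + 1
  · right; apply Equiv.swap_apply_of_ne_of_ne <;> omega
  · left; apply Equiv.swap_apply_of_ne_of_ne <;> omega

theorem tog_comm (D : Set (ℕ × ℕ)) (m k : ℕ) (hk : m + 2 ≤ k) :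
    Commute (tog D m) (tog D k) := by
  apply Equiv.ext
  intro f
  simp only [Equiv.Perm.mul_apply]
  have h3 : ∀ x, Equiv.swap m (m + 1) (Equiv.swap k (k + 1) x)
      = Equiv.swap k (k + 1) (Equiv.swap m (m + 1) x) := by
    intro x
    have := congrArg (fun e : Equiv.Perm ℕ => e x) (swap_far_comm m k hk).eq
    simpa using this
  have e1 := adjVals_swap_far D m k (Or.inl hk) f
  have e2 := adjVals_swap_far D k m (Or.inr hk) f
  by_cases h1 : AdjVals D m f <;> by_cases h2 : AdjVals D k f <;>
    simp only [tog_apply, h1, h2, e1, e2, if_true, if_false]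
  funext c
  simp [h3]

/-- The combined group. -/
abbrev HH := Equiv.Perm ℕ × Equiv.Perm Fil

/-- Generators of the combined group. -/
noncomputable def uu (D : Set (ℕ × ℕ)) (m : ℕ) : HH := (Equiv.swap m (m + 1), tog D m)

theorem uu_inv (D : Set (ℕ × ℕ)) (m : ℕ) : (uu D m)⁻¹ = uu D m := by
  apply Prod.ext
  · simp [uu]
  · rfl

theorem uu_comm (D : Set (ℕ × ℕ)) (m k : ℕ) (hk : m + 2 ≤ k) :
    Commute (uu D m) (uu D k) :=
  Prod.ext (swap_far_comm m k hk).eq (tog_comm D m k hk).eq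

/-- `WW D i d = u_{i+d-1} ⋯ u_{i+1} u_i`. -/
noncomputable def WW (D : Set (ℕ × ℕ)) (i : ℕ) : ℕ → HH
  | 0 => 1
  | d + 1 => uu D (i + d) * WW D i d

theorem WW_succ' (D : Set (ℕ × ℕ)) (i d : ℕ) : WW D i (d + 1) = WW D (i + 1) d * uu D i := by
  induction d with
  | zero => simp [WW]
  | succ d ih =>
    rw [WW, ih, WW, mul_assoc]
    congr 2
    omega

/-- Canonical words. -/
inductive Can (D : Set (ℕ × ℕ)) : ℕ → HH → Prop
  | nil (i : ℕ) : Can D i 1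
  | cons (i d : ℕ) (w : HH) : Can D (i + 1) w → Can D i (WW D i d * w)

theorem WW_comm (D : Set (ℕ × ℕ)) (i d j : ℕ) (h : j + 2 ≤ i) :
    Commute (uu D j) (WW D i d) := by
  induction d with
  | zero => exact Commute.one_right _
  | succ d ih => exact (uu_comm D j (i + d) (by omega)).mul_right ih

theorem Can.comm {D : Set (ℕ × ℕ)} {i : ℕ} {w : HH} (hw : Can D i w) (j : ℕ) (h : j + 2 ≤ i) :
    Commute (uu D j) w := by
  induction hw with
  | nil i => exact Commute.one_right _
  | cons i d w _ ih => exact (WW_comm D i d j h).mul_right (ih (by omega))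

theorem can_R (D : Set (ℕ × ℕ)) (d : ℕ) : ∀ i, Can D i (WW D i d)⁻¹ := by
  induction d with
  | zero => intro i; simpa [WW] using Can.nil (D := D) i
  | succ d ih =>
    intro i
    have := Can.cons i 1 _ (ih (i + 1))
    rw [WW_succ', mul_inv_rev, uu_inv]
    simpa [WW] using this

theorem Can.mul_R {D : Set (ℕ × ℕ)} {k : ℕ} {v : HH} (hv : Can D k v) :
    ∀ i d, k = i + 1 → Can D i (v * (WW D i d)⁻¹) := by
  induction hv with
  | nil k => intro i d _; simpa using can_R D d i
  | cons k e v hv ih =>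
    intro i d hk
    subst hk
    cases d with
    | zero =>
      have := Can.cons i 0 _ (Can.cons (i + 1) e v hv)
      simpa [WW] using this
    | succ d =>
      have := Can.cons i (e + 1) _ (ih (i + 1) d rfl)
      convert this using 1
      rw [WW_succ', WW_succ', mul_inv_rev, uu_inv]
      have hc := (hv.comm i (by omega)).eq
      simp only [mul_assoc]
      rw [← mul_assoc v, ← hc, mul_assoc]

theorem Can.inv {D : Set (ℕ × ℕ)} {i : ℕ} {w : HH} (hw : Can D i w) : Can D i w⁻¹ := by
  induction hw with
  | nil i => simpa using Can.nil (D := D) i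
  | cons i d w _ ih =>
    rw [mul_inv_rev]
    exact ih.mul_R i d rfl

theorem WW_fix (D : Set (ℕ × ℕ)) (i d x : ℕ) (h : x < i) : (WW D i d).1 x = x := by
  induction d with
  | zero => rfl
  | succ d ih =>
    simp only [WW, Prod.fst_mul, Equiv.Perm.mul_apply, ih, uu]
    apply Equiv.swap_apply_of_ne_of_ne <;> omega

theorem WW_first (D : Set (ℕ × ℕ)) (i d : ℕ) : (WW D i d).1 i = i + d := by
  induction d with
  | zero => rfl
  | succ d ih =>
    simp only [WW, Prod.fst_mul, Equiv.Perm.mul_apply, ih, uu]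
    rw [Equiv.swap_apply_left]; rfl

theorem Can.fix {D : Set (ℕ × ℕ)} {i : ℕ} {w : HH} (hw : Can D i w) (x : ℕ) (h : x < i) :
    w.1 x = x := by
  induction hw with
  | nil i => rfl
  | cons i d w _ ih =>
    rw [Prod.fst_mul, Equiv.Perm.mul_apply, ih (by omega), WW_fix D i d x h]

theorem Can.eq_one {D : Set (ℕ × ℕ)} {i : ℕ} {w : HH} (hw : Can D i w) (h : w.1 = 1) :
    w = 1 := by
  induction hw with
  | nil i => rfl
  | cons i d w hw ih =>
    have h1 : (WW D i d * w).1 i = i := by rw [h]; rfl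
    rw [Prod.fst_mul, Equiv.Perm.mul_apply, hw.fix i (by omega), WW_first] at h1
    obtain rfl : d = 0 := by omega
    have hW : WW D i 0 = 1 := rfl
    rw [hW, one_mul] at h ⊢
    exact ih h

theorem Can.unique {D : Set (ℕ × ℕ)} {i : ℕ} {w : HH} (hw : Can D i w) :
    ∀ w', Can D i w' → w.1 = w'.1 → w = w' := by
  induction hw with
  | nil i => intro w' hw' h; exact (hw'.eq_one h.symm).symm
  | cons i d w hw ih =>
    intro w' hw' h
    cases hw' with
    | nil => exact (Can.cons i d w hw).eq_one h
    | cons _ e v hv =>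
      have h1 : (WW D i d * w).1 i = (WW D i e * v).1 i := by rw [h]
      simp only [Prod.fst_mul, Equiv.Perm.mul_apply, hw.fix i (by omega), hv.fix i (by omega),
        WW_first] at h1
      obtain rfl : d = e := by omega
      simp only [Prod.fst_mul, mul_right_inj] at h
      rw [ih v hv h]

/-! ### Jeu de taquin versus toggles -/

theorem IsStandard.lt {D : Set (ℕ × ℕ)} {U : Fil} (hU : IsStandard D U) {a b : ℕ × ℕ}
    (ha : a ∈ D) (hb : b ∈ D) (h : Nb a b) : U a < U b := by
  rcases h with rfl | rfl
  · exact (hU.2 a ha).1 hb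
  · exact (hU.2 a ha).2 hb

theorem isStandard_of {D : Set (ℕ × ℕ)} {U : Fil} (hU : IsTabloid D U)
    (h : ∀ a ∈ D, ∀ b ∈ D, Nb a b → U a < U b) : IsStandard D U :=
  ⟨hU, fun c hc => ⟨fun h' => h c hc _ h' (Or.inl rfl), fun h' => h c hc _ h' (Or.inr rfl)⟩⟩

theorem IsTabloid.comp {D : Set (ℕ × ℕ)} {U : Fil} (hU : IsTabloid D U) (g : Equiv.Perm ℕ)
    (hg : PermOn D.ncard g) : IsTabloid D (g ∘ U) := by
  refine ⟨?_, fun c hc => ?_⟩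
  · refine Set.BijOn.comp (t := Set.Icc 1 D.ncard) ?_ hU.1
    refine ⟨?_, g.injective.injOn, ?_⟩
    · intro x hx
      by_contra h
      have := hg _ h
      rw [g.injective this] at h
      exact h hx
    · intro y hy
      refine ⟨g.symm y, ?_, by simp⟩
      by_contra h
      have := hg _ h
      rw [Equiv.apply_symm_apply] at this
      rw [← this] at h
      exact h hy
  · simp only [Function.comp, hU.2 c hc]
    exact hg 0 (by simp)

theorem permOn_swap (n m : ℕ) (h1 : 1 ≤ m) (h2 : m < n) : PermOn n (Equiv.swap m (m + 1)) := by
  intro x hx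
  simp only [Set.mem_Icc] at hx
  apply Equiv.swap_apply_of_ne_of_ne <;> omega

theorem tog_standard {D : Set (ℕ × ℕ)} {U : Fil} (hU : IsStandard D U) (m : ℕ) (h1 : 1 ≤ m)
    (h2 : m < D.ncard) : IsStandard D (tog D m U) := by
  rw [tog_apply]
  split_ifs with h
  · exact hU
  · refine isStandard_of (hU.1.comp _ (permOn_swap _ m h1 h2)) ?_
    intro a ha b hb hab
    have hlt := hU.lt ha hb hab
    have : ¬ (U a = m ∧ U b = m + 1) := fun h' => h ⟨a, ha, b, hb, hab, Or.inl h'⟩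
    simp only [Function.comp, Equiv.swap_apply_def]
    split_ifs <;> omega

theorem tog_low {D : Set (ℕ × ℕ)} {U : Fil} (m : ℕ) (c : ℕ × ℕ) (h : U c < m) :
    tog D m U c = U c := by
  rw [tog_apply]
  split_ifs
  · rfl
  · simp only [Function.comp]
    apply Equiv.swap_apply_of_ne_of_ne <;> omega

theorem nb_ne {c b : ℕ × ℕ} (h : Nb c b) : b ≠ c := by
  rcases h with rfl | rfl <;> simp [Prod.ext_iff]

theorem target_some {D : Set (ℕ × ℕ)} {T : Fil} {c c' : ℕ × ℕ} (hc : c ∈ D) (hc' : c' ∈ D)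
    (hn : Nb c c') (hlt : T c' < T c) (hmin : ∀ b ∈ D, Nb c b → b ≠ c' → T c' < T b) :
    fjTarget D T c = some c' := by
  unfold fjTarget
  rcases hn with rfl | rfl
  · have h1 : jval D T (c.1, c.2 + 1) ≤ jval D T (c.1 + 1, c.2) := by
      unfold jval
      rw [if_pos hc']
      split_ifs with hd
      · exact_mod_cast (hmin _ hd (Or.inr rfl) (by simp)).le
      · exact le_top
    have h2 : jval D T (c.1, c.2 + 1) < jval D T c := by
      unfold jval
      rw [if_pos hc', if_pos hc]
      exact_mod_cast hlt
    simp only [h1, min_eq_left, h2, if_true]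
  · have h1 : jval D T (c.1 + 1, c.2) < jval D T (c.1, c.2 + 1) := by
      unfold jval
      rw [if_pos hc']
      split_ifs with hd
      · exact_mod_cast hmin _ hd (Or.inl rfl) (by simp)
      · exact WithTop.coe_lt_top _
    have h2 : jval D T (c.1 + 1, c.2) < jval D T c := by
      unfold jval
      rw [if_pos hc', if_pos hc]
      exact_mod_cast hlt
    simp only [min_eq_right h1.le, h2, if_true, not_le.mpr h1, if_false]

theorem target_none {D : Set (ℕ × ℕ)} {T : Fil} {c : ℕ × ℕ} (hc : c ∈ D)
    (hmin : ∀ b ∈ D, Nb c b → T c < T b) : fjTarget D T c = none := by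
  have key : ∀ b, Nb c b → jval D T c ≤ jval D T b := by
    intro b hb
    unfold jval
    rw [if_pos hc]
    split_ifs with h
    · exact_mod_cast (hmin b h hb).le
    · exact le_top
  unfold fjTarget
  have := le_min (key _ (Or.inl rfl)) (key _ (Or.inr rfl))
  simp only [not_lt.mpr this, if_false]

theorem fjIter_none {D : Set (ℕ × ℕ)} {fuel : ℕ} {T X : Fil} {c : ℕ × ℕ}
    (h : fjTarget D T c = none) : (fjIter D fuel (T, X) c).1.1 = T := by
  cases fuel with
  | zero => rfl
  | succ f => simp [fjIter, h]

theorem run_lemma {D : Set (ℕ × ℕ)} (i : ℕ) (hi : 1 ≤ i) (r : ℕ) :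
    ∀ (m fuel : ℕ) (g : Equiv.Perm ℕ) (U X : Fil) (c : ℕ × ℕ),
    i ≤ m → m + r = D.ncard → r ≤ fuel → IsStandard D U → PermOn D.ncard g → c ∈ D → U c = m →
    (∀ a b, i ≤ a → a < b → b ≤ D.ncard → a ≠ m → b ≠ m → g a < g b) →
    (∀ a, i ≤ a → a < m → g a < g m) →
    ∃ e, ∃ g' : Equiv.Perm ℕ, g' = g * ((WW D m e).1)⁻¹ ∧
      (fjIter D fuel (g ∘ U, X) c).1.1 = g' ∘ ((WW D m e).2 U) ∧
      IsStandard D ((WW D m e).2 U) ∧ PermOn D.ncard g' ∧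
      (∀ x, U x < m → (WW D m e).2 U x = U x) ∧
      (∀ a b, i ≤ a → a < b → b ≤ D.ncard → g' a < g' b) := by
  induction r with
  | zero =>
    intro m fuel g U X c him hr hf hU hg hc hUc hmono hlt
    have hb : ∀ b ∈ D, U b ≤ D.ncard := fun b hb => (hU.1.1.mapsTo hb).2
    refine ⟨0, g, by simp [WW], ?_, by simpa [WW] using hU, hg, by simp [WW], ?_⟩
    · rw [fjIter_none]
      · simp [WW]
      · apply target_none hc
        intro b hbD hn
        have := hU.lt hc hbD hn
        have := hb b hbD
        omega
    · intro a b ha hab hbn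
      by_cases hbm : b = m
      · subst hbm; exact hlt a ha hab
      · exact hmono a b ha hab hbn (by omega) hbm
  | succ r ih =>
    intro m fuel g U X c him hr hf hU hg hc hUc hmono hlt
    have hb : ∀ b ∈ D, U b ≤ D.ncard := fun b hb => (hU.1.1.mapsTo hb).2
    by_cases hgm : g m < g (m + 1)
    · have hgm' : ∀ b, m < b → b ≤ D.ncard → g m < g b := by
        intro b hmb hbn
        by_cases h : b = m + 1
        · rwa [h]
        · exact hgm.trans (hmono (m + 1) b (by omega) (by omega) hbn (by omega) (by omega))
      refine ⟨0, g, by simp [WW], ?_, by simpa [WW] using hU, hg, by simp [WW], ?_⟩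
      · rw [fjIter_none]
        · simp [WW]
        · apply target_none hc
          intro b hbD hn
          have h1 := hU.lt hc hbD hn
          have h2 := hb b hbD
          simp only [Function.comp, hUc]
          exact hgm' _ (by omega) h2
      · intro a b ha hab hbn
        by_cases hbm : b = m
        · subst hbm; exact hlt a ha hab
        · by_cases ham : a = m
          · subst ham; exact hgm' b hab hbn
          · exact hmono a b ha hab hbn ham hbm
    · have hgm2 : g (m + 1) < g m := by
        have : g m ≠ g (m + 1) := fun h => by have := g.injective h; omega
        omega
      set g1 : Equiv.Perm ℕ := g * Equiv.swap m (m + 1) with hg1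
      have g1m : g1 m = g (m + 1) := by simp [hg1]
      have g1m1 : g1 (m + 1) = g m := by simp [hg1]
      have g1o : ∀ a, a ≠ m → a ≠ m + 1 → g1 a = g a := by
        intro a h1 h2
        simp [hg1, Equiv.swap_apply_of_ne_of_ne h1 h2]
      have hsw := permOn_swap D.ncard m (by omega) (by omega)
      have hg1p : PermOn D.ncard g1 := by
        intro x hx
        simp only [hg1, Equiv.Perm.mul_apply, hsw x hx, hg x hx]
      have hU1 := tog_standard hU m (by omega) (by omega)
      have hmono1 : ∀ a b, i ≤ a → a < b → b ≤ D.ncard → a ≠ m + 1 → b ≠ m + 1 →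
          g1 a < g1 b := by
        intro a b ha hab hbn ha1 hb1
        by_cases ham : a = m
        · subst ham
          rw [g1m, g1o b (by omega) hb1]
          exact hmono _ _ (by omega) (by omega) hbn (by omega) (by omega)
        · by_cases hbm : b = m
          · subst hbm
            rw [g1m, g1o a ham ha1]
            exact hmono _ _ (by omega) (by omega) (by omega) (by omega) (by omega)
          · rw [g1o a ham ha1, g1o b hbm hb1]
            exact hmono a b ha hab hbn ham hbm
      have hlt1 : ∀ a, i ≤ a → a < m + 1 → g1 a < g1 (m + 1) := by
        intro a ha ham
        rw [g1m1]
        by_cases h : a = m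
        · subst h; rw [g1m]; exact hgm2
        · rw [g1o a h (by omega)]; exact hlt a ha (by omega)
      -- it suffices to give the intermediate state
      suffices hmain : ∃ fuel' X' c', r ≤ fuel' ∧ c' ∈ D ∧ tog D m U c' = m + 1 ∧
          (fjIter D fuel (g ∘ U, X) c).1.1 =
            (fjIter D fuel' (g1 ∘ (tog D m U), X') c').1.1 by
        obtain ⟨fuel', X', c', hf', hc', hUc', heq⟩ := hmain
        obtain ⟨e, g', h1, h2, h3, h4, h5, h6⟩ :=
          ih (m + 1) fuel' g1 (tog D m U) X' c' (by omega) (by omega) hf' hU1 hg1p hc' hUc'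
            hmono1 hlt1
        have hW2 : (WW D m (e + 1)).2 U = (WW D (m + 1) e).2 (tog D m U) := by
          rw [WW_succ']; rfl
        refine ⟨e + 1, g', ?_, ?_, ?_, h4, ?_, h6⟩
        · rw [h1, WW_succ', Prod.fst_mul, mul_inv_rev, hg1, mul_assoc]
          simp [uu]
        · rw [hW2, heq, h2]
        · rw [hW2]; exact h3
        · intro x hx
          have := tog_low (D := D) m x hx
          rw [hW2, h5 x (by omega), this]
      by_cases hadj : AdjVals D m U
      · have htog : tog D m U = U := by rw [tog_apply, if_pos hadj]
        have : ∃ c' ∈ D, Nb c c' ∧ U c' = m + 1 := by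
          obtain ⟨a, ha, b, hbD, hn, h | h⟩ := hadj
          · have : a = c := hU.1.1.injOn ha hc (by omega)
            subst this
            exact ⟨b, hbD, hn, h.2⟩
          · have := hU.lt ha hbD hn
            omega
        obtain ⟨c', hc', hn, hUc'⟩ := this
        obtain ⟨f, rfl⟩ : ∃ f, fuel = f + 1 := ⟨fuel - 1, by omega⟩
        have htar : fjTarget D (g ∘ U) c = some c' := by
          apply target_some hc hc' hn
          · simpa [hUc, hUc'] using hgm2
          · intro b hbD hnb hne
            have h1 := hU.lt hc hbD hnb
            have h2 : U b ≠ m + 1 := fun h => hne (hU.1.1.injOn hbD hc' (by omega))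
            simp only [Function.comp, hUc']
            exact hmono _ _ (by omega) (by omega) (hb b hbD) (by omega) (by omega)
        refine ⟨f, swapCells X c c', c', by omega, hc', by rw [htog, hUc'], ?_⟩
        have hsc : swapCells (g ∘ U) c c' = g1 ∘ U := by
          funext x
          unfold swapCells
          by_cases hx' : x = c'
          · subst hx'
            simp [hUc, hUc', g1m1]
          · rw [Function.update_of_ne hx']
            by_cases hx : x = c
            · subst hx
              simp [hUc, hUc', g1m]
            · rw [Function.update_of_ne hx]
              simp only [Function.comp]
              by_cases hxD : x ∈ D
              · rw [g1o]
                · exact fun h => hx (hU.1.1.injOn hxD hc (by omega))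
                · exact fun h => hx' (hU.1.1.injOn hxD hc' (by omega))
              · rw [hU.1.2 x hxD, g1o] <;> omega
        rw [htog, ← hsc]
        simp [fjIter, htar]
      · have htog : tog D m U = Equiv.swap m (m + 1) ∘ U := by rw [tog_apply, if_neg hadj]
        refine ⟨fuel, X, c, by omega, hc, by rw [htog]; simp [hUc], ?_⟩
        have : g1 ∘ (tog D m U) = g ∘ U := by
          rw [htog]; funext x; simp [hg1]
        rw [this]

theorem cellOf_eq {D : Set (ℕ × ℕ)} {P : Fil} (hP : IsTabloid D P) {v : ℕ} (h1 : 1 ≤ v)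
    (h2 : v ≤ D.ncard) : cellOf D P v ∈ D ∧ P (cellOf D P v) = v := by
  obtain ⟨c, hc, hv⟩ := hP.1.surjOn (show v ∈ Set.Icc 1 D.ncard from ⟨h1, h2⟩)
  exact Classical.epsilon_spec (p := fun c => c ∈ D ∧ P c = v) ⟨c, hc, hv⟩

theorem stage_lemma {D : Set (ℕ × ℕ)} {P : Fil} (hP : IsStandard D P) (σ : Equiv.Perm ℕ)
    (hσ : PermOn D.ncard σ) (k : ℕ) : ∀ i, i + k = D.ncard →
    ∃ (g : Equiv.Perm ℕ) (w : HH), Can D (i + 1) w ∧ g * w.1 = σ ∧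
      MJaux D P D.ncard k (σ ∘ P) = g ∘ (w.2 P) ∧ IsStandard D (w.2 P) ∧ PermOn D.ncard g ∧
      (∀ x, P x ≤ i → w.2 P x = P x) ∧
      (∀ a b, i + 1 ≤ a → a < b → b ≤ D.ncard → g a < g b) := by
  induction k with
  | zero =>
    intro i hi
    refine ⟨σ, 1, Can.nil _, by simp, by simp [MJaux], by simpa using hP, hσ, by simp, ?_⟩
    intro a b ha hab hb
    omega
  | succ k ih =>
    intro i hi
    obtain ⟨g, w, hcan, hgw, hM, hstd, hgp, hlow, hmono⟩ := ih (i + 1) (by omega)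
    have hidx : D.ncard - k = i + 1 := by omega
    obtain ⟨hcD, hcv⟩ := cellOf_eq hP.1 (v := i + 1) (by omega) (by omega)
    obtain ⟨e, g', h1, h2, h3, h4, h5, h6⟩ :=
      run_lemma (D := D) (i + 1) (by omega) k (i + 1) D.ncard g (w.2 P) (g ∘ (w.2 P))
        (cellOf D P (i + 1)) le_rfl (by omega) (by omega) hstd hgp hcD
        (by rw [hlow _ (by omega), hcv])
        (fun a b ha hab hb ha' _ => hmono a b (by omega) hab hb)
        (fun a ha hab => by omega)
    refine ⟨g', WW D (i + 1) e * w, Can.cons _ _ _ hcan, ?_, ?_, h3, h4, ?_, h6⟩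
    · rw [h1, Prod.fst_mul, ← hgw]; group
    · rw [MJaux, hM, hidx]; exact h2
    · intro x hx
      have := hlow x (by omega)
      have h := h5 x (by omega)
      rw [this] at h
      exact h

theorem perm_eq_one {n : ℕ} {g : Equiv.Perm ℕ} (hg : PermOn n g)
    (hmono : ∀ a b, 1 ≤ a → a < b → b ≤ n → g a < g b) : g = 1 := by
  have hin : ∀ a, 1 ≤ a → a ≤ n → 1 ≤ g a ∧ g a ≤ n := by
    intro a h1 h2
    by_contra h
    have := g.injective (hg (g a) h)
    rw [this] at h
    exact h ⟨h1, h2⟩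
  have h0 : g 0 = 0 := hg 0 (by simp)
  have hbig : ∀ b, n < b → g b = b := fun b hb => hg b (by simp; omega)
  have hs : StrictMono g := by
    intro a b hab
    by_cases hb : b ≤ n
    · by_cases ha : 1 ≤ a
      · exact hmono a b ha hab hb
      · obtain rfl : a = 0 := by omega
        rw [h0]; have := hin b (by omega) hb; omega
    · rw [hbig b (by omega)]
      by_cases ha : a ≤ n
      · by_cases ha1 : 1 ≤ a
        · have := hin a ha1 ha; omega
        · obtain rfl : a = 0 := by omega
          omega
      · rw [hbig a (by omega)]; exact hab
  apply Equiv.ext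
  intro x
  have h1 := hs.le_apply (x := x)
  have hs' : StrictMono g.symm := by
    intro a b hab
    rw [← hs.lt_iff_lt]; simpa using hab
  have h2 := hs'.le_apply (x := g x)
  simp only [Equiv.symm_apply_apply] at h2
  exact le_antisymm h2 h1

theorem MJ_eq {D : Set (ℕ × ℕ)} {P : Fil} (hP : IsStandard D P) (σ : Equiv.Perm ℕ)
    (hσ : PermOn D.ncard σ) : ∃ w : HH, Can D 1 w ∧ w.1 = σ ∧ MJ D P (σ ∘ P) = w.2 P := by
  obtain ⟨g, w, hcan, hgw, hM, _, hgp, _, hmono⟩ := stage_lemma hP σ hσ D.ncard 0 (by omega)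
  have : g = 1 := perm_eq_one hgp (fun a b ha hab hb => hmono a b (by omega) hab hb)
  subst this
  exact ⟨w, hcan, by simpa using hgw, by rw [MJ, hM]; rfl⟩

theorem PermOn.inv {n : ℕ} {σ : Equiv.Perm ℕ} (h : PermOn n σ) : PermOn n σ⁻¹ := by
  intro x hx
  rw [Equiv.Perm.inv_eq_iff_eq]
  exact (h x hx).symm

theorem MJ_symm {D : Set (ℕ × ℕ)} {P Q : Fil} (hP : IsStandard D P) (hQ : IsStandard D Q)
    (σ : Equiv.Perm ℕ) (hσ : PermOn D.ncard σ) (h : MJ D P (σ ∘ P) = Q) :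
    MJ D Q ((σ⁻¹ : Equiv.Perm ℕ) ∘ Q) = P := by
  obtain ⟨w, hw, hw1, hw2⟩ := MJ_eq hP σ hσ
  obtain ⟨v, hv, hv1, hv2⟩ := MJ_eq hQ σ⁻¹ hσ.inv
  have : v = w⁻¹ := hv.unique _ hw.inv (by rw [hv1, Prod.fst_inv, hw1])
  rw [hv2, this, ← h, hw2, Prod.snd_inv]
  simp

theorem exists_perm {D : Set (ℕ × ℕ)} {P T : Fil} (hP : IsTabloid D P) (hT : IsTabloid D T) :
    ∃ σ : Equiv.Perm ℕ, PermOn D.ncard σ ∧ σ ∘ P = T := by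
  let eP := hP.1.equiv
  let eT := hT.1.equiv
  refine ⟨Equiv.Perm.ofSubtype (eP.symm.trans eT), ?_, ?_⟩
  · intro x hx
    exact Equiv.Perm.ofSubtype_apply_of_not_mem _ hx
  · funext c
    simp only [Function.comp]
    by_cases hc : c ∈ D
    · have hm : P c ∈ Set.Icc 1 D.ncard := hP.1.mapsTo hc
      rw [Equiv.Perm.ofSubtype_apply_of_mem _ hm]
      have h1 : (⟨P c, hm⟩ : Set.Icc 1 D.ncard) = eP ⟨c, hc⟩ := rfl
      rw [h1, Equiv.trans_apply, Equiv.symm_apply_apply]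
      rfl
    · rw [hP.2 c hc, hT.2 c hc]
      exact Equiv.Perm.ofSubtype_apply_of_not_mem _ (by simp)

theorem comp_inj {D : Set (ℕ × ℕ)} {P : Fil} (hP : IsTabloid D P) {σ τ : Equiv.Perm ℕ}
    (hσ : PermOn D.ncard σ) (hτ : PermOn D.ncard τ) (h : σ ∘ P = τ ∘ P) : σ = τ := by
  apply Equiv.ext
  intro x
  by_cases hx : x ∈ Set.Icc 1 D.ncard
  · obtain ⟨c, hc, rfl⟩ := hP.1.surjOn hx
    exact congrFun h c
  · rw [hσ x hx, hτ x hx]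

theorem count_eq {D : Set (ℕ × ℕ)} {P : Fil} (hP : IsStandard D P) (Q : Fil) :
    {T : Fil | IsTabloid D T ∧ MJ D P T = Q}.ncard =
      {σ : Equiv.Perm ℕ | PermOn D.ncard σ ∧ MJ D P (σ ∘ P) = Q}.ncard := by
  rw [← Set.ncard_image_of_injOn (f := fun σ : Equiv.Perm ℕ => (σ ∘ P : Fil))
    (fun σ hσ τ hτ h => comp_inj hP.1 hσ.1 hτ.1 h)]
  congr 1
  ext T
  constructor
  · rintro ⟨hT, h⟩
    obtain ⟨σ, hσ, rfl⟩ := exists_perm hP.1 hT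
    exact ⟨σ, ⟨hσ, h⟩, rfl⟩
  · rintro ⟨σ, ⟨hσ, h⟩, rfl⟩
    exact ⟨hP.1.comp σ hσ, h⟩

/-- Corollary: for standard skew tableaux `P, Q` of the same
(shifted or unshifted) skew shape, `A_{P,Q} = A_{Q,P}`, where `A_{P,Q}` is the
number of tabloids `T` of that shape with `MJ_P(T) = Q`. -/
theorem A_symmetric (sh : SkewShape) (P Q : ℕ × ℕ → ℕ)
    (hP : IsStandard sh.cells P) (hQ : IsStandard sh.cells Q) :
    {T : ℕ × ℕ → ℕ | IsTabloid sh.cells T ∧ MJ sh.cells P T = Q}.ncard =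
      {T : ℕ × ℕ → ℕ | IsTabloid sh.cells T ∧ MJ sh.cells Q T = P}.ncard := by
  rw [count_eq hP Q, count_eq hQ P, ← Set.ncard_image_of_injective _ (inv_injective (G := Equiv.Perm ℕ))]
  congr 1
  ext τ
  constructor
  · rintro ⟨σ, ⟨hσ, h⟩, rfl⟩
    exact ⟨hσ.inv, MJ_symm hP hQ σ hσ h⟩
  · rintro ⟨hτ, h⟩
    exact ⟨τ⁻¹, ⟨hτ.inv, MJ_symm hQ hP τ hτ h⟩, inv_inv τ⟩
end

section
/- For every pair (T,S) consisting of a tabloid T and a standard skew tableau S of the same (shifted or unshifted) skew shape, FJ(T,S) = BJ(T,S); that is, the forward operation FJ coincides with the backward operation BJ on such pairs. -/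
open scoped Classical

namespace FJBJ

/-- Pairs of fillings. -/
abbrev P := (ℕ × ℕ → ℕ) × (ℕ × ℕ → ℕ)

/-- `d` is the right or lower neighbour of `c`. -/
def Adj (c d : ℕ × ℕ) : Prop := d = (c.1, c.2 + 1) ∨ d = (c.1 + 1, c.2)

/-- Simultaneous exchange. -/
def sw (p : P) (a b : ℕ × ℕ) : P := (swapCells p.1 a b, swapCells p.2 a b)

/-- Simultaneous permutation of cells. -/
def pm (p : P) (s : Equiv.Perm (ℕ × ℕ)) : P := (p.1 ∘ s, p.2 ∘ s)

lemma swapCells_eq (f : ℕ × ℕ → ℕ) (a b : ℕ × ℕ) : swapCells f a b = f ∘ Equiv.swap a b := by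
  funext x
  unfold swapCells
  by_cases hb : x = b
  · subst hb; simp
  · by_cases ha : x = a
    · subst ha; simp [hb]
    · simp [hb, ha, Equiv.swap_apply_of_ne_of_ne ha hb]

lemma sw_eq (p : P) (a b : ℕ × ℕ) : sw p a b = pm p (Equiv.swap a b) := by
  simp [sw, pm, swapCells_eq]

lemma swapCells_comm (f : ℕ × ℕ → ℕ) (a b : ℕ × ℕ) : swapCells f a b = swapCells f b a := by
  rw [swapCells_eq, swapCells_eq, Equiv.swap_comm]

lemma swapCells_apply (f : ℕ × ℕ → ℕ) (a b x : ℕ × ℕ) :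
    swapCells f a b x = if x = b then f a else if x = a then f b else f x := by
  unfold swapCells
  simp [Function.update_apply]

lemma Adj.ne {c d : ℕ × ℕ} (h : Adj c d) : c ≠ d := by
  rcases h with h | h <;> rintro rfl <;> simp [Prod.ext_iff] at h

lemma Adj.sum {c d : ℕ × ℕ} (h : Adj c d) : d.1 + d.2 = c.1 + c.2 + 1 := by
  rcases h with h | h <;> subst h <;> simp <;> omega

/-- Forward slides (big-step relation). -/
inductive FS (D : Set (ℕ × ℕ)) : P → ℕ × ℕ → P → Prop
  | halt {p c} : fjTarget D p.1 c = none → FS D p c p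
  | step {p c c' q} : fjTarget D p.1 c = some c' → FS D (sw p c c') c' q → FS D p c q

/-- Backward slides, driven by the second filling. -/
inductive BS (D : Set (ℕ × ℕ)) : P → ℕ × ℕ → P → ℕ × ℕ → Prop
  | halt {p c} : bjTarget D p.2 c = none → BS D p c p c
  | step {p c c' q e} : bjTarget D p.2 c = some c' → BS D (sw p c c') c' q e → BS D p c q e

/-- Forward run over the labels `k, k-1, …, 1`. -/
inductive FR (D : Set (ℕ × ℕ)) : ℕ → P → P → Prop
  | zero {p} : FR D 0 p p
  | skip {k p q} : (∀ a ∈ D, p.2 a ≠ k + 1) → FR D k p q → FR D (k + 1) p q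
  | step {k p p' q a} : a ∈ D → p.2 a = k + 1 → FS D p a p' → FR D k p' q → FR D (k + 1) p q

/-- Backward run. -/
inductive BR : Set (ℕ × ℕ) → P → P → Prop
  | nil {p} : BR ∅ p p
  | cons {D p c p1 c1 q} : c ∈ D → (∀ d ∈ D, d ≠ c → p.1 c < p.1 d) → BS D p c p1 c1 →
      BR (D \ {c1}) p1 q → BR D p q

lemma fjTarget_some {D : Set (ℕ × ℕ)} {f : ℕ × ℕ → ℕ} {c c' : ℕ × ℕ}
    (h : fjTarget D f c = some c') : Adj c c' ∧ c' ∈ D := by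
  unfold fjTarget jval at h
  unfold Adj
  by_cases h1 : (c.1, c.2 + 1) ∈ D <;> by_cases h2 : (c.1 + 1, c.2) ∈ D <;>
    simp only [h1, h2, if_true, if_false] at h <;> split_ifs at h <;> simp_all <;> grind

lemma fjTarget_congr {D D' : Set (ℕ × ℕ)} {f g : ℕ × ℕ → ℕ} {c : ℕ × ℕ}
    (hc : c ∈ D) (hc' : c ∈ D') (hfg : f c = g c)
    (h : ∀ d, Adj c d → ((d ∈ D ↔ d ∈ D') ∧ (d ∈ D → f d = g d))) :
    fjTarget D f c = fjTarget D' g c := by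
  have h1 := h (c.1, c.2 + 1) (Or.inl rfl)
  have h2 := h (c.1 + 1, c.2) (Or.inr rfl)
  have e1 : jval D f (c.1, c.2 + 1) = jval D' g (c.1, c.2 + 1) := by
    unfold jval; grind
  have e2 : jval D f (c.1 + 1, c.2) = jval D' g (c.1 + 1, c.2) := by
    unfold jval; grind
  have e3 : jval D f c = jval D' g c := by
    unfold jval; grind
  unfold fjTarget
  simp only [e1, e2, e3]

lemma fjTarget_min {D : Set (ℕ × ℕ)} {f : ℕ × ℕ → ℕ} {c : ℕ × ℕ} (hc : c ∈ D)
    (h : ∀ d ∈ D, d ≠ c → f c < f d) : fjTarget D f c = none := by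
  have h1 := h (c.1, c.2 + 1)
  have h2 := h (c.1 + 1, c.2)
  unfold fjTarget jval
  by_cases h1' : (c.1, c.2 + 1) ∈ D <;> by_cases h2' : (c.1 + 1, c.2) ∈ D <;>
    simp [h1', h2', hc, Prod.ext_iff] at h1 h2 ⊢ <;> first | omega | skip

lemma fjTarget_to_min {D : Set (ℕ × ℕ)} {f : ℕ × ℕ → ℕ} {a c : ℕ × ℕ} (ha : a ∈ D) (hc : c ∈ D)
    (hac : Adj a c) (h : ∀ d ∈ D, d ≠ c → f c < f d) : fjTarget D f a = some c := by
  have h0 := h a ha hac.ne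
  rcases hac with rfl | rfl
  · have h2 := h (a.1 + 1, a.2)
    unfold fjTarget jval
    by_cases h2' : (a.1 + 1, a.2) ∈ D <;>
      simp [h2', hc, ha, Prod.ext_iff] at h2 ⊢ <;> grind
  · have h2 := h (a.1, a.2 + 1)
    unfold fjTarget jval
    by_cases h2' : (a.1, a.2 + 1) ∈ D <;>
      simp [h2', hc, ha, Prod.ext_iff] at h2 ⊢ <;> grind

lemma adj_left {c : ℕ × ℕ} (h : 0 < c.2) : Adj (c.1, c.2 - 1) c := by
  left; ext <;> simp; omega

lemma adj_up {c : ℕ × ℕ} (h : 0 < c.1) : Adj (c.1 - 1, c.2) c := by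
  right; ext <;> simp; omega

lemma adj_cases {x c : ℕ × ℕ} (h : Adj x c) :
    (0 < c.2 ∧ x = (c.1, c.2 - 1)) ∨ (0 < c.1 ∧ x = (c.1 - 1, c.2)) := by
  rcases h with rfl | rfl <;> simp

lemma bjTarget_some' {D : Set (ℕ × ℕ)} {f : ℕ × ℕ → ℕ} {c c' : ℕ × ℕ}
    (hpos : ∀ d ∈ D, 0 < f d)
    (h : bjTarget D f c = some c') :
    Adj c' c ∧ c' ∈ D ∧ ∀ x ∈ D, Adj x c → f x ≤ f c' := by
  have hl := hpos (c.1, c.2 - 1)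
  have hu := hpos (c.1 - 1, c.2)
  have al := @adj_left c
  have au := @adj_up c
  have key : ∀ x, Adj x c → (0 < c.2 ∧ x = (c.1, c.2 - 1)) ∨ (0 < c.1 ∧ x = (c.1 - 1, c.2)) :=
    fun x => adj_cases
  unfold bjTarget at h
  grind

lemma bjTarget_none {D : Set (ℕ × ℕ)} {f : ℕ × ℕ → ℕ} {c : ℕ × ℕ} :
    bjTarget D f c = none ↔ ∀ x ∈ D, ¬ Adj x c := by
  have al := @adj_left c
  have au := @adj_up c
  have key : ∀ x, Adj x c → (0 < c.2 ∧ x = (c.1, c.2 - 1)) ∨ (0 < c.1 ∧ x = (c.1 - 1, c.2)) :=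
    fun x => adj_cases
  unfold bjTarget
  grind

lemma bjTarget_congr {D : Set (ℕ × ℕ)} {f g : ℕ × ℕ → ℕ} {c : ℕ × ℕ}
    (h : ∀ d ∈ D, Adj d c → f d = g d) : bjTarget D f c = bjTarget D g c := by
  have al := @adj_left c
  have au := @adj_up c
  have hl := h (c.1, c.2 - 1)
  have hu := h (c.1 - 1, c.2)
  unfold bjTarget
  grind

/-- Without positivity. -/
lemma bjTarget_some {D : Set (ℕ × ℕ)} {f : ℕ × ℕ → ℕ} {c c' : ℕ × ℕ}
    (hpos : ∀ d ∈ D, 0 < f d) (h : bjTarget D f c = some c') : Adj c' c ∧ c' ∈ D :=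
  ⟨(bjTarget_some' hpos h).1, (bjTarget_some' hpos h).2.1⟩

/-- `V` is closed under right and lower neighbours within `D`. -/
def Up (D V : Set (ℕ × ℕ)) : Prop := ∀ v ∈ V, ∀ w ∈ D, Adj v w → w ∈ V

lemma FS_perm {D V : Set (ℕ × ℕ)} (hV : Up D V) {X a X'} (h : FS D X a X') (ha : a ∈ V) :
    ∃ s : Equiv.Perm (ℕ × ℕ), (∀ d, d ∉ V → s d = d) ∧ X' = pm X s := by
  induction h with
  | halt _ => exact ⟨1, by simp, rfl⟩
  | @step p c c' q ht _ ih =>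
    obtain ⟨h1, h2⟩ := fjTarget_some ht
    have hc' := hV _ ha _ h2 h1
    obtain ⟨s, hs, rfl⟩ := ih hc'
    refine ⟨Equiv.swap c c' * s, ?_, ?_⟩
    · intro d hd
      rw [Equiv.Perm.mul_apply, hs d hd, Equiv.swap_apply_of_ne_of_ne] <;> grind
    · rw [sw_eq]; rfl

lemma FS_local {D D' V : Set (ℕ × ℕ)} (hV : Up D V) (hVD : V ⊆ D) (hD' : D' ⊆ D) (hVD' : V ⊆ D')
    {X a X'} (h : FS D X a X') (ha : a ∈ V) (Y : P)
    (h1 : ∀ d ∈ V, X.1 d = Y.1 d) (h2 : ∀ d ∈ V, X.2 d = Y.2 d) :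
    FS D' Y a (V.piecewise X'.1 Y.1, V.piecewise X'.2 Y.2) := by
  induction h generalizing Y with
  | @halt p c ht =>
    have e : (V.piecewise p.1 Y.1, V.piecewise p.2 Y.2) = Y := by
      ext x
      · by_cases hx : x ∈ V <;> simp [hx, h1]
      · by_cases hx : x ∈ V <;> simp [hx, h2]
    rw [e]
    apply FS.halt
    rw [← ht]
    symm
    apply fjTarget_congr (hVD ha) (hVD' ha) (h1 _ ha)
    intro d hd
    have := hV _ ha d
    refine ⟨⟨fun h => hVD' (this h hd), fun h => hD' h⟩, fun h => h1 _ (this h hd)⟩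
  | @step p c c' q ht _ ih =>
    obtain ⟨g1, g2⟩ := fjTarget_some ht
    have hc' := hV _ ha _ g2 g1
    have ht' : fjTarget D' Y.1 c = some c' := by
      rw [← ht]
      symm
      apply fjTarget_congr (hVD ha) (hVD' ha) (h1 _ ha)
      intro d hd
      have := hV _ ha d
      refine ⟨⟨fun h => hVD' (this h hd), fun h => hD' h⟩, fun h => h1 _ (this h hd)⟩
    apply FS.step ht'
    have := ih hc' (sw Y c c') ?_ ?_
    · convert this using 2
      · funext x
        by_cases hx : x ∈ V
        · simp [hx]
        · simp only [hx, not_false_eq_true, Set.piecewise_eq_of_notMem, sw, swapCells_apply]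
          grind
      · funext x
        by_cases hx : x ∈ V
        · simp [hx]
        · simp only [hx, not_false_eq_true, Set.piecewise_eq_of_notMem, sw, swapCells_apply]
          grind
    · intro d hd
      simp only [sw, swapCells_apply]
      grind
    · intro d hd
      simp only [sw, swapCells_apply]
      grind

lemma pos_sw {D : Set (ℕ × ℕ)} {f : ℕ × ℕ → ℕ} {a b} (ha : a ∈ D) (hb : b ∈ D)
    (h : ∀ d ∈ D, 0 < f d) : ∀ d ∈ D, 0 < swapCells f a b d := by
  intro d hd
  rw [swapCells_apply]
  split_ifs
  · exact h _ ha
  · exact h _ hb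
  · exact h _ hd

lemma BS_perm {D Q : Set (ℕ × ℕ)} (hQD : Q ⊆ D) (hQ : ∀ q ∈ Q, ∀ x ∈ D, Adj x q → x ∈ Q)
    {X b Y c1} (h : BS D X b Y c1) (hb : b ∈ Q) (hpos : ∀ d ∈ D, 0 < X.2 d) :
    ∃ s : Equiv.Perm (ℕ × ℕ), (∀ d, d ∉ Q → s d = d) ∧ Y = pm X s ∧ s c1 = b ∧ c1 ∈ Q := by
  induction h with
  | halt _ => exact ⟨1, by simp, rfl, rfl, hb⟩
  | @step p c c' q e ht _ ih =>
    obtain ⟨h1, h2⟩ := bjTarget_some hpos ht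
    have hc' := hQ _ hb _ h2 h1
    obtain ⟨s, hs, rfl, hs1, hs2⟩ := ih hc' (pos_sw (hQD hb) h2 hpos)
    refine ⟨Equiv.swap c c' * s, ?_, ?_, ?_, hs2⟩
    · intro d hd
      rw [Equiv.Perm.mul_apply, hs d hd, Equiv.swap_apply_of_ne_of_ne] <;> grind
    · rw [sw_eq]; rfl
    · simp [hs1]

lemma BS_local {D Q : Set (ℕ × ℕ)} (hQD : Q ⊆ D) (hQ : ∀ q ∈ Q, ∀ x ∈ D, Adj x q → x ∈ Q)
    {X b Y c1} (h : BS D X b Y c1) (hb : b ∈ Q) (hpos : ∀ d ∈ D, 0 < X.2 d) (X' : P)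
    (h1 : ∀ d ∈ Q, X.1 d = X'.1 d) (h2 : ∀ d ∈ Q, X.2 d = X'.2 d) :
    BS D X' b (Q.piecewise Y.1 X'.1, Q.piecewise Y.2 X'.2) c1 := by
  induction h generalizing X' with
  | @halt p c ht =>
    have e : (Q.piecewise p.1 X'.1, Q.piecewise p.2 X'.2) = X' := by
      ext x
      · by_cases hx : x ∈ Q <;> simp [hx, h1]
      · by_cases hx : x ∈ Q <;> simp [hx, h2]
    rw [e]
    apply BS.halt
    rw [bjTarget_none] at ht ⊢
    exact ht
  | @step p c c' q e ht _ ih =>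
    obtain ⟨g1, g2⟩ := bjTarget_some hpos ht
    have hc' := hQ _ hb _ g2 g1
    have ht' : bjTarget D X'.2 c = some c' := by
      rw [← ht]
      symm
      apply bjTarget_congr
      intro d hd hdc
      exact h2 _ (hQ _ hb _ hd hdc)
    apply BS.step ht'
    have := ih hc' (pos_sw (hQD hb) g2 hpos) (sw X' c c') ?_ ?_
    · convert this using 2
      · funext x
        by_cases hx : x ∈ Q
        · simp [hx]
        · simp only [hx, not_false_eq_true, Set.piecewise_eq_of_notMem, sw, swapCells_apply]
          grind
      · funext x
        by_cases hx : x ∈ Q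
        · simp [hx]
        · simp only [hx, not_false_eq_true, Set.piecewise_eq_of_notMem, sw, swapCells_apply]
          grind
    · intro d hd
      simp only [sw, swapCells_apply]
      grind
    · intro d hd
      simp only [sw, swapCells_apply]
      grind

lemma commute {D V : Set (ℕ × ℕ)} (hV : Up D V) (hVD : V ⊆ D) {X a X' b Y c1}
    (hF : FS D X a X') (ha : a ∈ V) (hB : BS D X b Y c1) (hb : b ∈ D \ V)
    (hpos : ∀ d ∈ D, 0 < X.2 d) :
    c1 ∈ D \ V ∧ Y.2 a = X.2 a ∧ ∃ Y', FS (D \ {c1}) Y a Y' ∧ BS D X' b Y' c1 := by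
  have hQD : D \ V ⊆ D := Set.diff_subset
  have hQ : ∀ q ∈ D \ V, ∀ x ∈ D, Adj x q → x ∈ D \ V :=
    fun q hq x hx hxq => ⟨hx, fun hxV => hq.2 (hV x hxV q hq.1 hxq)⟩
  obtain ⟨s, hs, hX'⟩ := FS_perm hV hF ha
  obtain ⟨t, ht, hY, -, hc1⟩ := BS_perm hQD hQ hB hb hpos
  have eX1 : ∀ d, d ∉ V → X'.1 d = X.1 d := fun d hd => by rw [hX']; simp [pm, hs d hd]
  have eX2 : ∀ d, d ∉ V → X'.2 d = X.2 d := fun d hd => by rw [hX']; simp [pm, hs d hd]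
  have eY1 : ∀ d, d ∉ D \ V → Y.1 d = X.1 d := fun d hd => by rw [hY]; simp [pm, ht d hd]
  have eY2 : ∀ d, d ∉ D \ V → Y.2 d = X.2 d := fun d hd => by rw [hY]; simp [pm, ht d hd]
  refine ⟨hc1, eY2 a (fun h => h.2 ha), _,
    FS_local hV hVD (D' := D \ {c1}) Set.diff_subset ?_ hF ha Y ?_ ?_, ?_⟩
  · intro v hv
    refine ⟨hVD hv, ?_⟩
    rintro rfl
    exact hc1.2 hv
  · intro d hd; exact (eY1 d (fun h => h.2 hd)).symm
  · intro d hd; exact (eY2 d (fun h => h.2 hd)).symm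
  · have := BS_local hQD hQ hB hb hpos X' (fun d hd => (eX1 d hd.2).symm)
      (fun d hd => (eX2 d hd.2).symm)
    convert this using 2
    · funext x
      by_cases hx : x ∈ V <;> by_cases hx' : x ∈ D <;> simp [Set.piecewise, hx, hx']
      rw [eX1 x hx, eY1 x (fun h => hx' h.1)]
    · funext x
      by_cases hx : x ∈ V <;> by_cases hx' : x ∈ D <;> simp [Set.piecewise, hx, hx']
      rw [eX2 x hx, eY2 x (fun h => hx' h.1)]

/-- The cells labelled `≤ k` form an order ideal on which labels increase. -/
def W (D : Set (ℕ × ℕ)) (k : ℕ) (f : ℕ × ℕ → ℕ) : Prop :=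
  ∀ d ∈ D, ∀ d' ∈ D, Adj d d' → f d' ≤ k → f d < f d'

lemma perm_maps {D V : Set (ℕ × ℕ)} (hVD : V ⊆ D) {s : Equiv.Perm (ℕ × ℕ)}
    (hs : ∀ d, d ∉ V → s d = d) {d} : (d ∈ V → s d ∈ V) ∧ (d ∈ D → s d ∈ D) := by
  have : d ∈ V → s d ∈ V := by
    intro hd
    by_contra hn
    have := hs _ hn
    have := s.injective this
    rw [this] at hn
    exact hn hd
  refine ⟨this, fun hd => ?_⟩
  by_cases h : d ∈ V
  · exact hVD (this h)
  · rw [hs d h]; exact hd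

/-- Invariants of the state together with the position `b` of the minimal entry. -/
structure Inv (D : Set (ℕ × ℕ)) (k : ℕ) (X : P) (b : ℕ × ℕ) : Prop where
  inj : Set.InjOn X.2 D
  pos : ∀ d ∈ D, 0 < X.2 d
  w : W D k X.2
  mem : b ∈ D
  min : ∀ d ∈ D, d ≠ b → X.1 b < X.1 d
  nb : ∀ x ∈ D, Adj x b → X.2 x ≤ k

lemma core {D : Set (ℕ × ℕ)} {k X a X' b Y c1} (hI : Inv D k X b) (ha : a ∈ D)
    (hk : X.2 a = k + 1) (hab : a ≠ b) (hF : FS D X a X') (hB : BS D X b Y c1) :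
    Inv D k X' b ∧ a ∈ D \ {c1} ∧ Y.2 a = k + 1 ∧
      ∃ Y', FS (D \ {c1}) Y a Y' ∧ BS D X' b Y' c1 := by
  obtain ⟨inj, pos, w, mem, min, nb⟩ := hI
  let V : Set (ℕ × ℕ) := {v | v ∈ D ∧ k + 1 ≤ X.2 v ∧ v ≠ b}
  have hVD : V ⊆ D := fun v hv => hv.1
  have hV : Up D V := by
    intro v hv u hu hvu
    obtain ⟨h1, h2, h3⟩ := hv
    refine ⟨hu, ?_, ?_⟩
    · by_contra hc
      have := w v h1 u hu hvu (by omega)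
      omega
    · rintro rfl
      have := nb v h1 hvu
      omega
  have haV : a ∈ V := ⟨ha, by omega, hab⟩
  have hbV : b ∉ V := fun h => h.2.2 rfl
  obtain ⟨h1, h2, h3⟩ := commute hV hVD hF haV hB ⟨mem, hbV⟩ pos
  refine ⟨?_, ⟨ha, fun h => h1.2 (by rw [Set.mem_singleton_iff] at h; exact h ▸ haV)⟩,
    by omega, h3⟩
  obtain ⟨s, hs, rfl⟩ := FS_perm hV hF haV
  have hm := fun d => @perm_maps D V hVD s hs d
  have hsV : ∀ d ∈ V, k + 1 ≤ X.2 (s d) := fun d hd => ((hm d).1 hd).2.1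
  refine ⟨?_, ?_, ?_, mem, ?_, ?_⟩
  · intro x hx y hy hxy
    exact s.injective (inj ((hm x).2 hx) ((hm y).2 hy) hxy)
  · intro d hd; exact pos _ ((hm d).2 hd)
  · intro d hd d' hd' had hle
    simp only [pm, Function.comp] at hle ⊢
    have hd'V : d' ∉ V := fun h => by have := hsV _ h; omega
    have hdV : d ∉ V := fun h => hd'V (hV d h d' hd' had)
    rw [hs _ hd'V] at hle ⊢
    rw [hs _ hdV]
    exact w d hd d' hd' had hle
  · intro d hd hdb
    simp only [pm, Function.comp]
    rw [hs b hbV]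
    refine min _ ((hm d).2 hd) ?_
    intro h
    rw [← hs b hbV] at h
    exact hdb (s.injective h)
  · intro x hx hxb
    simp only [pm, Function.comp]
    have hxV : x ∉ V := fun h => hbV (hV x h b mem hxb)
    rw [hs x hxV]
    exact nb x hx hxb

lemma comm {D : Set (ℕ × ℕ)} {k X q b Y c1} (hF : FR D k X q) (hI : Inv D k X b)
    (hB : BS D X b Y c1) : FR (D \ {c1}) k Y q := by
  induction hF generalizing b Y c1 with
  | @zero p =>
    cases hB with
    | halt _ => exact FR.zero
    | step ht _ =>
      obtain ⟨h1, h2⟩ := bjTarget_some hI.pos ht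
      have := hI.nb _ h2 h1
      have := hI.pos _ h2
      omega
  | @skip k p q hn _ ih =>
    obtain ⟨inj, pos, w, mem, min, nb⟩ := hI
    obtain ⟨s, hs, hY, hs1, -⟩ := BS_perm (Q := D) subset_rfl (fun _ _ x hx _ => hx) hB mem pos
    refine FR.skip ?_ (ih ⟨inj, pos, ?_, mem, min, ?_⟩ hB)
    · intro a ha
      rw [hY]
      exact hn _ ((perm_maps subset_rfl hs).2 ha.1)
    · intro d hd d' hd' had hle
      exact w d hd d' hd' had (by omega)
    · intro x hx hxb
      have := nb x hx hxb
      have := hn x hx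
      omega
  | @step k p p' q a ha hka hFS _ ih =>
    have hI0 := hI
    obtain ⟨inj, pos, w, mem, min, nb⟩ := hI
    by_cases hab : a = b
    · subst hab
      have hp' : p' = p := by
        cases hFS with
        | halt _ => rfl
        | step ht _ => rw [fjTarget_min ha min] at ht; cases ht
      subst hp'
      obtain ⟨s, hs, hY, hs1, hc1⟩ :=
        BS_perm (Q := D) subset_rfl (fun _ _ x hx _ => hx) hB mem pos
      refine FR.skip ?_ (ih ⟨inj, pos, ?_, mem, min, ?_⟩ hB)
      · intro d hd h
        rw [hY] at h
        have h' : p'.2 (s d) = p'.2 a := by rw [hka]; exact h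
        have := inj ((perm_maps subset_rfl hs).2 hd.1) ha h'
        rw [← hs1] at this
        exact hd.2 (s.injective this)
      · intro d hd d' hd' had hle
        exact w d hd d' hd' had (by omega)
      · intro x hx hxb
        have := w x hx a ha hxb (by omega)
        omega
    · by_cases hadj : Adj a b
      · have hFS1 : FS D (sw p a b) b p' := by
          have ht := fjTarget_to_min ha mem hadj min
          cases hFS with
          | halt h => rw [ht] at h; cases h
          | step h h' => rw [ht] at h; cases h; exact h'
        have hBS1 : BS D (sw p a b) a Y c1 := by
          cases hB with
          | halt h => rw [bjTarget_none] at h; exact absurd hadj (h a ha)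
          | @step _ _ c' _ _ h h' =>
            obtain ⟨g1, g2, g3⟩ := bjTarget_some' pos h
            have e1 := g3 a ha hadj
            have e2 := nb c' g2 g1
            have : c' = a := inj g2 ha (by omega)
            subst this
            have e : sw p c' b = sw p b c' := by
              unfold sw
              rw [swapCells_comm p.1, swapCells_comm p.2]
            rw [e]; exact h'
        have hb : k + 1 < p.2 b := by
          by_contra hc
          have := w a ha b mem hadj (by omega)
          omega
        have hI1 : Inv D k (sw p a b) a := by
          refine ⟨?_, pos_sw ha mem pos, ?_, ha, ?_, ?_⟩
          · intro x hx y hy hxy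
            simp only [sw, swapCells_apply] at hxy
            have := @inj
            unfold Set.InjOn at this
            grind
          · intro d hd d' hd' had hle
            have := w d hd d' hd' had
            simp only [sw, swapCells_apply] at hle ⊢
            grind
          · intro d hd hda
            have := min d hd
            have := min a ha hab
            simp only [sw, swapCells_apply]
            grind
          · intro x hx hxa
            have h3 := w x hx a ha hxa (by omega)
            have : x ≠ b := by rintro rfl; omega
            have : x ≠ a := hxa.ne
            simp only [sw, swapCells_apply]
            grind
        have hk1 : (sw p a b).2 b = k + 1 := by simp [sw, swapCells_apply, hka]
        obtain ⟨r1, r2, r3, Y', r4, r5⟩ := core hI1 mem hk1 (Ne.symm hab) hFS1 hBS1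
        exact FR.step r2 r3 r4 (ih r1 r5)
      · have hI1 : Inv D k p b := by
          refine ⟨inj, pos, ?_, mem, min, ?_⟩
          · intro d hd d' hd' had hle
            exact w d hd d' hd' had (by omega)
          · intro x hx hxb
            have h1 := nb x hx hxb
            have h2 : p.2 x ≠ k + 1 := by
              intro h
              have : x = a := inj hx ha (by omega)
              subst this
              exact hadj hxb
            omega
        obtain ⟨r1, r2, r3, Y', r4, r5⟩ := core hI1 ha hka hab hFS hB
        exact FR.step r2 r3 r4 (ih r1 r5)

lemma BS_inc {D : Set (ℕ × ℕ)} {X b Y c1} (h : BS D X b Y c1) (hb : b ∈ D)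
    (inj : Set.InjOn X.2 D) (pos : ∀ d ∈ D, 0 < X.2 d)
    (h1 : ∀ d ∈ D, ∀ d' ∈ D, d ≠ b → d' ≠ b → Adj d d' → X.2 d < X.2 d')
    (h2 : ∀ l ∈ D, ∀ r ∈ D, Adj l b → Adj b r → X.2 l < X.2 r) :
    ∀ d ∈ D, ∀ d' ∈ D, d ≠ c1 → d' ≠ c1 → Adj d d' → Y.2 d < Y.2 d' := by
  induction h with
  | halt _ => exact h1
  | @step p c c' q e ht _ ih =>
    obtain ⟨g1, g2, g3⟩ := bjTarget_some' pos ht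
    have hne := g1.ne
    refine ih g2 ?_ (pos_sw hb g2 pos) ?_ ?_
    · intro x hx y hy hxy
      simp only [sw, swapCells_apply] at hxy
      have := @inj
      unfold Set.InjOn at this
      grind
    · intro d hd d' hd' hdc hdc' had
      have hdd := had.ne
      simp only [sw, swapCells_apply, hdc, hdc', if_false]
      by_cases e1 : d = c
      · subst e1
        rw [if_pos rfl, if_neg (Ne.symm hdd)]
        exact h2 _ g2 _ hd' g1 had
      · rw [if_neg e1]
        by_cases e2 : d' = c
        · subst e2
          rw [if_pos rfl]
          refine lt_of_le_of_ne (g3 d hd had) fun h => hdc (inj hd g2 h)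
        · rw [if_neg e2]
          exact h1 d hd d' hd' e1 e2 had
    · intro l hl r hr hlc hcr
      have s1 := hlc.sum
      have s2 := g1.sum
      have hl1 : l ≠ c := by rintro rfl; omega
      have hl2 : l ≠ c' := hlc.ne
      have hr2 : r ≠ c' := hcr.ne.symm
      have k1 := h1 l hl c' g2 hl1 hne hlc
      simp only [sw, swapCells_apply, hl1, hl2, hr2, if_false]
      by_cases e1 : r = c
      · rw [if_pos e1]; exact k1
      · rw [if_neg e1]
        exact k1.trans (h1 c' g2 r hr hne e1 hcr)

lemma main {D : Set (ℕ × ℕ)} {n : ℕ} {X q q' : P} (hB : BR D X q') (hF : FR D n X q)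
    (inj : Set.InjOn X.2 D) (pos : ∀ d ∈ D, 0 < X.2 d) (hle : ∀ d ∈ D, X.2 d ≤ n)
    (inc : ∀ d ∈ D, ∀ d' ∈ D, Adj d d' → X.2 d < X.2 d') : q = q' := by
  induction hB with
  | @nil p =>
    clear inj pos hle inc
    generalize hD : (∅ : Set (ℕ × ℕ)) = D at hF
    induction hF with
    | zero => rfl
    | skip _ _ ih => exact ih
    | step h _ _ _ _ => subst hD; exact absurd h (Set.notMem_empty _)
  | @cons D p c p1 c1 q' hc hmin hBS _ ih =>
    have hI : Inv D n p c := ⟨inj, pos, fun d hd d' hd' had _ => inc d hd d' hd' had, hc, hmin,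
      fun x hx _ => hle x hx⟩
    have hF1 := comm hF hI hBS
    obtain ⟨s, hs, hY, hs1, hc1⟩ :=
      BS_perm (Q := D) subset_rfl (fun _ _ x hx _ => hx) hBS hc pos
    have hm : ∀ d ∈ D, s d ∈ D := fun d hd => (perm_maps subset_rfl hs).2 hd
    have hinc := BS_inc hBS hc inj pos (fun d hd d' hd' _ _ had => inc d hd d' hd' had)
      (fun l hl r hr h1 h2 => (inc l hl c hc h1).trans (inc c hc r hr h2))
    refine ih hF1 ?_ ?_ ?_ ?_
    · rw [hY]
      intro x hx y hy hxy
      exact s.injective (inj (hm x hx.1) (hm y hy.1) hxy)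
    · rw [hY]; intro d hd; exact pos _ (hm d hd.1)
    · rw [hY]; intro d hd; exact hle _ (hm d hd.1)
    · intro d hd d' hd' had
      exact hinc d hd.1 d' hd'.1 hd.2 hd'.2 had

/-! ### Connection with the fuelled definitions -/

lemma fjIter_FS {D : Set (ℕ × ℕ)} (hD : D.Finite) (N : ℕ) (p : P) (c : ℕ × ℕ)
    (hN : {d ∈ D | c.1 + c.2 < d.1 + d.2}.ncard ≤ N) : FS D p c (fjIter D N p c).1 := by
  induction N generalizing p c with
  | zero =>
    rw [fjIter]
    apply FS.halt
    rcases h : fjTarget D p.1 c with _ | c'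
    · rfl
    · obtain ⟨h1, h2⟩ := fjTarget_some h
      have h3 := h1.sum
      have : 0 < {d ∈ D | c.1 + c.2 < d.1 + d.2}.ncard := by
        rw [Set.ncard_pos (hD.subset (Set.sep_subset _ _))]
        exact ⟨c', h2, by omega⟩
      omega
  | succ N ih =>
    rw [fjIter]
    rcases h : fjTarget D p.1 c with _ | c'
    · exact FS.halt h
    · obtain ⟨h1, h2⟩ := fjTarget_some h
      have h3 := h1.sum
      refine FS.step h (ih _ _ ?_)
      have : {d ∈ D | c'.1 + c'.2 < d.1 + d.2}.ncard < {d ∈ D | c.1 + c.2 < d.1 + d.2}.ncard := by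
        apply Set.ncard_lt_ncard _ (hD.subset (Set.sep_subset _ _))
        refine ⟨fun d hd => ⟨hd.1, by have := hd.2; omega⟩, fun hs => ?_⟩
        have := (hs (a := c') ⟨h2, by omega⟩).2
        omega
      omega

lemma bjIter_BS {D : Set (ℕ × ℕ)} (hD : D.Finite) (N : ℕ) (p : P) (c : ℕ × ℕ) (hc : c ∈ D)
    (hpos : ∀ d ∈ D, 0 < p.2 d)
    (hN : {d ∈ D | d.1 + d.2 < c.1 + c.2}.ncard ≤ N) :
    ∃ e, BS D p c ((bjIter D N (p.2, p.1) c).1.2, (bjIter D N (p.2, p.1) c).1.1) e := by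
  induction N generalizing p c with
  | zero =>
    rw [bjIter]
    refine ⟨c, BS.halt ?_⟩
    rcases h : bjTarget D p.2 c with _ | c'
    · rfl
    · obtain ⟨h1, h2⟩ := bjTarget_some hpos h
      have h3 := h1.sum
      have : 0 < {d ∈ D | d.1 + d.2 < c.1 + c.2}.ncard := by
        rw [Set.ncard_pos (hD.subset (Set.sep_subset _ _))]
        exact ⟨c', h2, by omega⟩
      omega
  | succ N ih =>
    rw [bjIter]
    rcases h : bjTarget D p.2 c with _ | c'
    · simp only [h]; exact ⟨c, BS.halt h⟩
    · obtain ⟨h1, h2⟩ := bjTarget_some hpos h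
      have h3 := h1.sum
      have hlt : {d ∈ D | d.1 + d.2 < c'.1 + c'.2}.ncard
          < {d ∈ D | d.1 + d.2 < c.1 + c.2}.ncard := by
        apply Set.ncard_lt_ncard _ (hD.subset (Set.sep_subset _ _))
        refine ⟨fun d hd => ⟨hd.1, by have := hd.2; omega⟩, fun hs => ?_⟩
        have := (hs (a := c') ⟨h2, by omega⟩).2
        omega
      obtain ⟨e, he⟩ := ih (sw p c c') c' h2 (pos_sw hc h2 hpos) (by omega)
      simp only [h]
      exact ⟨e, BS.step h he⟩

lemma cellOf_spec {D : Set (ℕ × ℕ)} {f : ℕ × ℕ → ℕ} {v : ℕ} (h : ∃ c, c ∈ D ∧ f c = v) :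
    cellOf D f v ∈ D ∧ f (cellOf D f v) = v :=
  Classical.epsilon_spec h

lemma FJaux_FR {D : Set (ℕ × ℕ)} (hD : D.Finite) {T S : ℕ × ℕ → ℕ} {n : ℕ} (hn : n = D.ncard)
    (hS : IsStandard D S) (k : ℕ) (hk : k ≤ n) :
    (∀ d ∈ D, S d ≤ n - k → (FJaux D S n k (T, S)).2 d = S d) ∧
    ∀ q, FR D (n - k) (FJaux D S n k (T, S)) q → FR D n (T, S) q := by
  induction k with
  | zero => exact ⟨fun _ _ _ => rfl, fun q h => h⟩
  | succ k ih =>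
    obtain ⟨i1, i2⟩ := ih (by omega)
    have hex : ∃ c, c ∈ D ∧ S c = n - k :=
      hS.1.1.surjOn (show n - k ∈ Set.Icc 1 D.ncard from ⟨by omega, by omega⟩)
    obtain ⟨ha, hSa⟩ := cellOf_spec hex
    rw [FJaux]
    have hFS := fjIter_FS hD D.ncard (FJaux D S n k (T, S)) (cellOf D S (n - k))
      (Set.ncard_le_ncard (Set.sep_subset _ _) hD)
    set a := cellOf D S (n - k)
    constructor
    · let V : Set (ℕ × ℕ) := {d | d ∈ D ∧ n - k ≤ S d}
      have hV : Up D V := by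
        intro v hv w hw hvw
        have := hS.2 v hv.1
        have hv2 := hv.2
        refine ⟨hw, ?_⟩
        rcases hvw with rfl | rfl
        · have := this.1 hw; omega
        · have := this.2 hw; omega
      obtain ⟨s, hs, he⟩ := FS_perm hV hFS ⟨ha, hSa.ge⟩
      intro d hd hdk
      have hdV : d ∉ V := fun h => by have := h.2; omega
      rw [he]
      simp only [pm, Function.comp]
      rw [hs d hdV]
      exact i1 d hd (by omega)
    · intro q hq
      apply i2
      have e : n - k = (n - (k + 1)) + 1 := by omega
      rw [e]
      refine FR.step ha ?_ hFS hq
      rw [i1 a ha (by omega)]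
      omega

lemma BJaux_BR {D : Set (ℕ × ℕ)} (hD : D.Finite) {T S : ℕ × ℕ → ℕ} 
    (hT : IsTabloid D T) (hS : IsStandard D S) (i : ℕ) (hi : i ≤ D.ncard) :
    (∃ s : Equiv.Perm (ℕ × ℕ), (∀ d, d ∉ D → s d = d) ∧ BJaux D i (T, S) = pm (T, S) s) ∧
    ∀ q, BR {c | c ∈ D ∧ i + 1 ≤ (BJaux D i (T, S)).1 c} (BJaux D i (T, S)) q →
      BR D (T, S) q := by
  induction i with
  | zero =>
    refine ⟨⟨1, by simp, rfl⟩, fun q h => ?_⟩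
    have : {c | c ∈ D ∧ 0 + 1 ≤ (BJaux D 0 (T, S)).1 c} = D := by
      ext c
      simp only [Set.mem_setOf_eq, BJaux, and_iff_left_iff_imp]
      intro hc
      exact (hT.1.mapsTo hc).1
    rwa [this] at h
  | succ i ih =>
    obtain ⟨⟨s, hs, he⟩, i2⟩ := ih (by omega)
    have hm : ∀ d, (d ∈ D → s d ∈ D) ∧ (d ∈ D → s d ∈ D) :=
      fun d => perm_maps subset_rfl hs
    rw [BJaux]
    set p := BJaux D i (T, S)
    have hex : ∃ c, c ∈ D ∧ p.1 c = i + 1 := by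
      obtain ⟨c, hc, hTc⟩ :=
        hT.1.surjOn (show i + 1 ∈ Set.Icc 1 D.ncard from ⟨by omega, by omega⟩)
      refine ⟨s.symm c, ?_, ?_⟩
      · by_contra h
        have h2 := hs _ h
        rw [Equiv.apply_symm_apply] at h2
        rw [← h2] at h
        exact h hc
      · rw [he]; simp [pm, hTc]
    obtain ⟨ha, hpa⟩ := cellOf_spec hex
    set a := cellOf D p.1 (i + 1)
    set E : Set (ℕ × ℕ) := {c | c ∈ D ∧ i + 1 ≤ p.1 c} with hE
    have hED : E ⊆ D := fun c hc => hc.1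
    have haE : a ∈ E := ⟨ha, hpa.ge⟩
    have hpos : ∀ d ∈ E, 0 < p.2 d := by
      intro d hd
      rw [he]
      exact (hS.1.1.mapsTo ((hm d).1 hd.1)).1
    have hinj : Set.InjOn p.1 D := by
      rw [he]
      intro x hx y hy hxy
      exact s.injective (hT.1.injOn ((hm x).1 hx) ((hm y).1 hy) hxy)
    obtain ⟨c1, hBS⟩ := bjIter_BS (hD.subset hED) D.ncard p a haE hpos
      (Set.ncard_le_ncard ((Set.sep_subset _ _).trans hED) hD)
    obtain ⟨t, ht, hY, ht1, hc1⟩ :=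
      BS_perm (Q := E) subset_rfl (fun _ _ x hx _ => hx) hBS haE hpos
    have htm : ∀ d, (d ∈ E → t d ∈ E) ∧ (d ∈ D → t d ∈ D) := fun d => perm_maps hED ht
    simp only
    set r : P := ((bjIter E D.ncard (p.2, p.1) a).1.2, (bjIter E D.ncard (p.2, p.1) a).1.1)
    constructor
    · refine ⟨s * t, ?_, ?_⟩
      · intro d hd
        rw [Equiv.Perm.mul_apply, ht d (fun h => hd (hED h)), hs d hd]
      · rw [hY, he]; rfl
    · intro q hq
      apply i2
      refine BR.cons haE ?_ hBS ?_
      · intro d hd hda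
        have h1 : p.1 d ≠ p.1 a := fun h => hda (hinj hd.1 ha h)
        have h2 := hd.2
        omega
      · convert hq using 1
        ext d
        simp only [Set.mem_diff, Set.mem_singleton_iff, Set.mem_setOf_eq]
        change d ∈ E ∧ ¬ d = c1 ↔ d ∈ D ∧ i + 1 + 1 ≤ r.1 d
        rw [hY]
        simp only [pm, Function.comp]
        constructor
        · rintro ⟨hd, hdc⟩
          refine ⟨hd.1, ?_⟩
          have h1 := (htm d).1 hd
          have h2 := h1.2
          have h3 : p.1 (t d) ≠ i + 1 := by
            intro h
            rw [← hpa] at h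
            have := hinj h1.1 ha h
            rw [← ht1] at this
            exact hdc (t.injective this)
          omega
        · rintro ⟨hd, hle⟩
          constructor
          · by_contra hdE
            rw [ht d hdE] at hle
            exact hdE ⟨hd, by omega⟩
          · rintro rfl
            rw [ht1, hpa] at hle
            omega

lemma final {D : Set (ℕ × ℕ)} {T S : ℕ × ℕ → ℕ} (hT : IsTabloid D T) (hS : IsStandard D S) :
    FJ D T S = BJ D T S := by
  have hD : D.Finite := by
    have := hT.1.image_eq
    apply Set.Finite.of_finite_image _ hT.1.injOn
    rw [this]
    exact Set.finite_Icc _ _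
  unfold FJ BJ
  congr 1
  have hF := (FJaux_FR hD (T := T) rfl hS D.ncard le_rfl).2 (FJaux D S D.ncard D.ncard (T, S))
    (by rw [Nat.sub_self]; exact FR.zero)
  obtain ⟨⟨s, hs, he⟩, h2⟩ := BJaux_BR hD hT hS D.ncard le_rfl
  have hB := h2 (BJaux D D.ncard (T, S)) (by
    have : {c | c ∈ D ∧ D.ncard + 1 ≤ (BJaux D D.ncard (T, S)).1 c} = ∅ := by
      ext d
      simp only [Set.mem_setOf_eq, Set.mem_empty_iff_false, iff_false, not_and, not_le]
      intro hd
      rw [he]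
      have := (hT.1.mapsTo ((perm_maps subset_rfl hs).2 hd)).2
      simp only [pm, Function.comp]
      omega
    rw [this]
    exact BR.nil)
  refine main hB hF hS.1.1.injOn (fun d hd => (hS.1.1.mapsTo hd).1)
    (fun d hd => (hS.1.1.mapsTo hd).2) ?_
  intro d hd d' hd' had
  rcases had with rfl | rfl
  · exact (hS.2 d hd).1 hd'
  · exact (hS.2 d hd).2 hd'

end FJBJ

/-- for every tabloid `T` and standard skew tableau `S` of the
same (shifted or unshifted) skew shape, `FJ(T,S) = BJ(T,S)`. -/
theorem fj_eq_bj (sh : SkewShape) (T S : ℕ × ℕ → ℕ)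
    (hT : IsTabloid sh.cells T) (hS : IsStandard sh.cells S) :
    FJ sh.cells T S = BJ sh.cells T S := by
  exact FJBJ.final hT hS
end
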